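/- arXiv:1209.1605 — 2 statements merged into one kernel-verified Lean document; each statement's English description precedes it below -/
import Mathlib

section
/- Weighted Sobolev embedding on the boost region: Let n ≥ 1, θ ∈ (0,1], and let Ω_θ = {(x,t) ∈ ℝⁿ×ℝ : |t| ≤ θσ(x)}. Let s, s′ ∈ ℕ and δ, δ′ ∈ ℝ satisfy s′ < s − (n+1)/2 and δ′ < δ + (n+1)/2. Then there is a constant C, depending only on n, θ, s, s′, δ, δ′, such that every smooth u : Ω_θ → ℝ with ‖u‖_{H_{s+1,δ}(Ω_θ)} < ∞ satisfies σ(x)^{δ′+k} ‖Dᵏu(x,t)‖ ≤ C ‖u‖_{H_{s+1,δ}(Ω_θ)} for every integer 0 ≤ k ≤ s′ and every (x,t) ∈ Ω_θ. -/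
open MeasureTheory

/-- The boost region `Ω_θ = {(x,t) ∈ ℝⁿ×ℝ : |t| ≤ θσ(x)}` where `σ(x) = (1+|x|²)^{1/2}`. -/
def boostRegion (n : ℕ) (θ : ℝ) : Set (EuclideanSpace ℝ (Fin n) × ℝ) :=
  {p | |p.2| ≤ θ * Real.sqrt (1 + ‖p.1‖ ^ 2)}

/-- The weighted Sobolev norm on a set `U ⊆ ℝⁿ×ℝ`, valued in `ℝ≥0∞`:
`(Σ_{k=0}^{s} ∫_U σ(x)^{2(δ+k)} ‖Dᵏu(x,t)‖² dx dt)^{1/2}` with weight in the spatial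
variable only. -/
noncomputable def wSobOn (n s : ℕ) (δ : ℝ) (U : Set (EuclideanSpace ℝ (Fin n) × ℝ))
    (u : EuclideanSpace ℝ (Fin n) × ℝ → ℝ) : ENNReal :=
  (∑ k ∈ Finset.range (s + 1),
    ∫⁻ p in U,
      ENNReal.ofReal ((1 + ‖p.1‖ ^ 2) ^ (δ + (k : ℝ)) * ‖iteratedFDeriv ℝ k u p‖ ^ 2)) ^ (1/2 : ℝ)

/-- Taylor expansion at `1`, evaluated at `0`, with integral remainder. -/
theorem enorm_zero_le_sum_iteratedDeriv_add_lintegral {F : Type*} [NormedAddCommGroup F]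
    [NormedSpace ℝ F] [CompleteSpace F] {g : ℝ → F} (hg : ContDiff ℝ (⊤ : ℕ∞) g) (m : ℕ) :
    ‖g 0‖ₑ ≤ ∑ i ∈ Finset.range (m + 1), ‖iteratedDeriv i g 1‖ₑ +
      ∫⁻ τ in Set.Ioc (0 : ℝ) 1, ENNReal.ofReal (τ ^ m) * ‖iteratedDeriv (m + 1) g τ‖ₑ := by
  have hcont : ∀ i, Continuous (iteratedDeriv i g) := fun i =>
    hg.continuous_iteratedDeriv i (by exact_mod_cast le_top)
  have hderiv : ∀ i x, HasDerivAt (iteratedDeriv i g) (iteratedDeriv (i + 1) g x) x := by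
    intro i x
    rw [iteratedDeriv_succ]
    exact ((hg.differentiable_iteratedDeriv i
      (by exact_mod_cast WithTop.coe_lt_top i)) x).hasDerivAt
  have key : ‖g 0‖ ≤ ∑ i ∈ Finset.range (m + 1), ‖iteratedDeriv i g 1‖ +
      ‖∫ τ in (0 : ℝ)..1, τ ^ m • iteratedDeriv (m + 1) g τ‖ := by
    induction m with
    | zero =>
      have h := intervalIntegral.integral_eq_sub_of_hasDerivAt (a := 0) (b := 1)
        (fun x _ => hderiv 0 x) ((hcont 1).intervalIntegrable 0 1)
      have h' : g 0 = iteratedDeriv 0 g 1 - ∫ τ in (0 : ℝ)..1, τ ^ 0 • iteratedDeriv (0 + 1) g τ := by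
        simp only [pow_zero, one_smul, zero_add]
        rw [h]; simp
      calc ‖g 0‖ = _ := congrArg norm h'
        _ ≤ _ := norm_sub_le _ _
        _ = _ := by simp
    | succ m ih =>
      refine ih.trans ?_
      rw [Finset.sum_range_succ _ (m + 1), add_assoc]
      gcongr
      have hp : ∀ x : ℝ, HasDerivAt (fun x : ℝ => x ^ (m + 1)) (((m : ℝ) + 1) * x ^ m) x := by
        intro x; simpa using hasDerivAt_pow (m + 1) x
      have h := intervalIntegral.integral_smul_deriv_eq_deriv_smul (a := 0) (b := 1)
        (fun x _ => hp x) (fun x _ => hderiv (m + 1) x)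
        ((by fun_prop : Continuous fun x : ℝ => ((m : ℝ) + 1) * x ^ m).intervalIntegrable 0 1)
        ((hcont (m + 2)).intervalIntegrable 0 1)
      simp only [mul_smul, intervalIntegral.integral_smul] at h
      set J := ∫ τ in (0 : ℝ)..1, τ ^ m • iteratedDeriv (m + 1) g τ
      have h2 : ((m : ℝ) + 1) • J = iteratedDeriv (m + 1) g 1 -
          ∫ τ in (0 : ℝ)..1, τ ^ (m + 1) • iteratedDeriv (m + 1 + 1) g τ := by
        rw [h]; simp
      calc ‖J‖ ≤ ‖((m : ℝ) + 1) • J‖ := by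
            rw [norm_smul]
            refine le_mul_of_one_le_left (norm_nonneg _) ?_
            rw [Real.norm_of_nonneg (by positivity)]
            linarith [(Nat.cast_nonneg m : (0 : ℝ) ≤ m)]
        _ ≤ _ := by rw [h2]; exact norm_sub_le _ _
  have key' : ‖g 0‖ₑ ≤ ∑ i ∈ Finset.range (m + 1), ‖iteratedDeriv i g 1‖ₑ +
      ‖∫ τ in (0 : ℝ)..1, τ ^ m • iteratedDeriv (m + 1) g τ‖ₑ := by
    simp only [← ofReal_norm]
    rw [← ENNReal.ofReal_sum_of_nonneg (fun _ _ => norm_nonneg _),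
      ← ENNReal.ofReal_add (Finset.sum_nonneg fun _ _ => norm_nonneg _) (norm_nonneg _)]
    exact ENNReal.ofReal_le_ofReal key
  refine key'.trans ?_
  gcongr
  rw [intervalIntegral.integral_of_le zero_le_one]
  refine (enorm_integral_le_lintegral_enorm _).trans_eq ?_
  refine setLIntegral_congr_fun measurableSet_Ioc fun τ hτ => ?_
  simp only [enorm_smul]
  rw [Real.enorm_of_nonneg (pow_nonneg hτ.1.le m)]

/-- Currying of the first variable, as an isometry of spaces of continuous multilinear maps. -/
noncomputable def curryLeftIsometry (V G : Type*) [NormedAddCommGroup V] [NormedSpace ℝ V]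
    [NormedAddCommGroup G] [NormedSpace ℝ G] (k : ℕ) :
    (V [×(k + 1)]→L[ℝ] G) ≃ₗᵢ[ℝ] (V →L[ℝ] (V [×k]→L[ℝ] G)) :=
  continuousMultilinearCurryLeftEquiv ℝ (fun _ : Fin (k + 1) => V) G

theorem norm_iteratedFDeriv_iteratedFDeriv {V G : Type*} [NormedAddCommGroup V] [NormedSpace ℝ V]
    [NormedAddCommGroup G] [NormedSpace ℝ G] (f : V → G) (i k : ℕ) (x : V) :
    ‖iteratedFDeriv ℝ i (iteratedFDeriv ℝ k f) x‖ = ‖iteratedFDeriv ℝ (k + i) f x‖ := by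
  induction i generalizing k with
  | zero => simp
  | succ i ih =>
    have h : fderiv ℝ (iteratedFDeriv ℝ k f) =
        (curryLeftIsometry V G k) ∘ iteratedFDeriv ℝ (k + 1) f := by
      ext x v w
      rfl
    rw [← norm_iteratedFDeriv_fderiv, h, LinearIsometryEquiv.norm_iteratedFDeriv_comp_left, ih,
      add_right_comm, add_assoc]

theorem norm_iteratedDeriv_comp_line_le {V G : Type*} [NormedAddCommGroup V] [NormedSpace ℝ V]
    [NormedAddCommGroup G] [NormedSpace ℝ G] {f : V → G} (hf : ContDiff ℝ (⊤ : ℕ∞) f)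
    (p v : V) (i : ℕ) (τ : ℝ) :
    ‖iteratedDeriv i (fun r : ℝ => f (p + r • v)) τ‖ ≤
      ‖v‖ ^ i * ‖iteratedFDeriv ℝ i f (p + τ • v)‖ := by
  rw [← norm_iteratedFDeriv_eq_norm_iteratedDeriv]
  have hf' : ContDiff ℝ (⊤ : ℕ∞) (fun x => f (p + x)) := by fun_prop
  have := (ContinuousLinearMap.toSpanSingleton ℝ v).iteratedFDeriv_comp_right hf' τ
    (i := i) (by exact_mod_cast le_top)
  have h2 : (fun r : ℝ => f (p + r • v)) =
      (fun x => f (p + x)) ∘ (ContinuousLinearMap.toSpanSingleton ℝ v) := by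
    ext r; simp
  rw [h2, this, iteratedFDeriv_comp_add_left]
  refine (ContinuousMultilinearMap.norm_compContinuousLinearMap_le _ _).trans ?_
  simp [mul_comm]

theorem enorm_iteratedFDeriv_le_along_segment {V G : Type*} [NormedAddCommGroup V]
    [NormedSpace ℝ V] [NormedAddCommGroup G] [NormedSpace ℝ G] [CompleteSpace G] {u : V → G}
    (hu : ContDiff ℝ (⊤ : ℕ∞) u) (k m : ℕ) {p v : V} {L : NNReal} (hv : ‖v‖₊ ≤ L) :
    ‖iteratedFDeriv ℝ k u p‖ₑ ≤
      ∑ i ∈ Finset.range (m + 1), (L : ENNReal) ^ i * ‖iteratedFDeriv ℝ (k + i) u (p + v)‖ₑ +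
      L ^ (m + 1) * ∫⁻ τ in Set.Ioc (0 : ℝ) 1,
        ENNReal.ofReal (τ ^ m) * ‖iteratedFDeriv ℝ (k + (m + 1)) u (p + τ • v)‖ₑ := by
  have hD : ContDiff ℝ (⊤ : ℕ∞) (iteratedFDeriv ℝ k u) :=
    hu.iteratedFDeriv_right (by exact_mod_cast le_top)
  have hb : ∀ (i : ℕ) (τ : ℝ), ‖iteratedDeriv i (fun r : ℝ => iteratedFDeriv ℝ k u (p + r • v)) τ‖ₑ ≤
      (L : ENNReal) ^ i * ‖iteratedFDeriv ℝ (k + i) u (p + τ • v)‖ₑ := by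
    intro i τ
    have h := norm_iteratedDeriv_comp_line_le hD p v i τ
    rw [norm_iteratedFDeriv_iteratedFDeriv] at h
    have h' : ‖iteratedDeriv i (fun r : ℝ => iteratedFDeriv ℝ k u (p + r • v)) τ‖₊ ≤
      L ^ i * ‖iteratedFDeriv ℝ (k + i) u (p + τ • v)‖₊ := by
      refine le_trans (?_ : _ ≤ ‖v‖₊ ^ i * ‖iteratedFDeriv ℝ (k + i) u (p + τ • v)‖₊) (by gcongr)
      exact_mod_cast h
    simp only [enorm_eq_nnnorm]
    exact_mod_cast h'
  have hg : ContDiff ℝ (⊤ : ℕ∞) (fun r : ℝ => iteratedFDeriv ℝ k u (p + r • v)) := by fun_prop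
  have h := enorm_zero_le_sum_iteratedDeriv_add_lintegral hg m
  simp only [zero_smul, add_zero] at h
  refine h.trans ?_
  gcongr with i hi
  · simpa using hb i 1
  · rw [← lintegral_const_mul' _ _ (by finiteness)]
    refine lintegral_mono fun τ => ?_
    rw [mul_left_comm]
    gcongr
    exact hb _ _

theorem lintegral_comp_homothety_le {V : Type*} [NormedAddCommGroup V] [NormedSpace ℝ V]
    [FiniteDimensional ℝ V] [MeasurableSpace V] [BorelSpace V] (μ : Measure V)
    [μ.IsAddHaarMeasure] {h : V → ENNReal} (hh : Measurable h) {B S : Set V}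
    (hS : MeasurableSet S) (p : V) {τ : ℝ} (hτ : 0 < τ)
    (hBS : ∀ y ∈ B, p + τ • (y - p) ∈ S) :
    ∫⁻ y in B, h (p + τ • (y - p)) ∂μ ≤
      ENNReal.ofReal (τ⁻¹ ^ Module.finrank ℝ V) * ∫⁻ z in S, h z ∂μ := by
  have hmeas : Measurable fun y : V => p + τ • (y - p) := by fun_prop
  have h1 : ∫⁻ y in B, h (p + τ • (y - p)) ∂μ ≤
      ∫⁻ y in (fun y => p + τ • (y - p)) ⁻¹' S, h (p + τ • (y - p)) ∂μ :=
    lintegral_mono_set hBS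
  refine h1.trans_eq ?_
  rw [← setLIntegral_map hS hh hmeas]
  have h2 : (fun y : V => p + τ • (y - p)) =
      (fun z => (p - τ • p) + z) ∘ (fun y => τ • y) := by
    ext y; simp [smul_sub]; abel
  rw [h2, ← Measure.map_map (by fun_prop) (by fun_prop),
    Measure.map_addHaar_smul μ hτ.ne', Measure.map_smul, map_add_left_eq_self,
    Measure.restrict_smul, lintegral_smul_measure, smul_eq_mul]
  congr 2
  rw [abs_of_nonneg (by positivity), inv_pow]

theorem setLIntegral_le_measure_mul_sqrt {α : Type*} [MeasurableSpace α] (μ : Measure α)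
    {h : α → ENNReal} (hh : Measurable h) (B : Set α) :
    ∫⁻ y in B, h y ∂μ ≤ μ B ^ (1 / 2 : ℝ) * (∫⁻ y in B, h y ^ 2 ∂μ) ^ (1 / 2 : ℝ) := by
  have := ENNReal.lintegral_mul_le_Lp_mul_Lq (μ.restrict B) (p := 2) (q := 2)
    (by constructor <;> norm_num) (f := fun _ => 1) (g := h) (by fun_prop) hh.aemeasurable
  simpa using this

theorem enorm_iteratedFDeriv_mul_measure_le {V G : Type*} [NormedAddCommGroup V]
    [NormedSpace ℝ V] [FiniteDimensional ℝ V] [MeasurableSpace V] [BorelSpace V] (μ : Measure V)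
    [μ.IsAddHaarMeasure] [NormedAddCommGroup G] [NormedSpace ℝ G] [CompleteSpace G] {u : V → G}
    (hu : ContDiff ℝ (⊤ : ℕ∞) u) (k m : ℕ) (hm : Module.finrank ℝ V ≤ 2 * m) {B S : Set V}
    (hB : MeasurableSet B) (hS : MeasurableSet S) {p : V} {L : NNReal}
    (hL : ∀ y ∈ B, ‖y - p‖₊ ≤ L)
    (hBS : ∀ τ ∈ Set.Ioc (0 : ℝ) 1, ∀ y ∈ B, p + τ • (y - p) ∈ S) :
    ‖iteratedFDeriv ℝ k u p‖ₑ * μ B ≤ μ B ^ (1 / 2 : ℝ) *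
      ∑ i ∈ Finset.range (m + 2), (L : ENNReal) ^ i *
        (∫⁻ z in S, ‖iteratedFDeriv ℝ (k + i) u z‖ₑ ^ 2 ∂μ) ^ (1 / 2 : ℝ) := by
  have hcont : ∀ j, Continuous (iteratedFDeriv ℝ j u) := fun j =>
    hu.continuous_iteratedFDeriv (by exact_mod_cast le_top)
  have hmeas : ∀ j, Measurable fun z => ‖iteratedFDeriv ℝ j u z‖ₑ := fun j =>
    (hcont j).enorm.measurable
  have hE : ∀ (j : ℕ), ∀ τ ∈ Set.Ioc (0 : ℝ) 1,
      ∫⁻ y in B, ‖iteratedFDeriv ℝ j u (p + τ • (y - p))‖ₑ ∂μ ≤ μ B ^ (1 / 2 : ℝ) *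
        (ENNReal.ofReal (τ⁻¹ ^ Module.finrank ℝ V) *
          ∫⁻ z in S, ‖iteratedFDeriv ℝ j u z‖ₑ ^ 2 ∂μ) ^ (1 / 2 : ℝ) := by
    intro j τ hτ
    refine (setLIntegral_le_measure_mul_sqrt μ ((hmeas j).comp (by fun_prop)) B).trans ?_
    gcongr
    exact lintegral_comp_homothety_le μ (h := fun z => ‖iteratedFDeriv ℝ j u z‖ₑ ^ 2)
      ((hmeas j).pow_const 2) hS p hτ.1 (hBS τ hτ)
  have hrem : ∫⁻ y in B, ∫⁻ τ in Set.Ioc (0 : ℝ) 1, ENNReal.ofReal (τ ^ m) *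
        ‖iteratedFDeriv ℝ (k + (m + 1)) u (p + τ • (y - p))‖ₑ ∂volume ∂μ ≤
      μ B ^ (1 / 2 : ℝ) *
        (∫⁻ z in S, ‖iteratedFDeriv ℝ (k + (m + 1)) u z‖ₑ ^ 2 ∂μ) ^ (1 / 2 : ℝ) := by
    rw [lintegral_lintegral_swap]
    swap
    · refine Measurable.aemeasurable ?_
      have : Continuous fun q : V × ℝ => p + q.2 • (q.1 - p) := by fun_prop
      exact Measurable.mul (by fun_prop) ((hmeas _).comp this.measurable)
    calc _ ≤ ∫⁻ τ in Set.Ioc (0 : ℝ) 1, μ B ^ (1 / 2 : ℝ) *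
          (∫⁻ z in S, ‖iteratedFDeriv ℝ (k + (m + 1)) u z‖ₑ ^ 2 ∂μ) ^ (1 / 2 : ℝ) := by
          refine setLIntegral_mono' measurableSet_Ioc fun τ hτ => ?_
          rw [lintegral_const_mul' _ _ (by finiteness)]
          refine (mul_le_mul_right (hE _ τ hτ) _).trans ?_
          rw [mul_left_comm]
          gcongr
          rw [ENNReal.mul_rpow_of_nonneg _ _ (by norm_num), ← mul_assoc]
          refine mul_le_of_le_one_left (zero_le) ?_
          have h1 : ENNReal.ofReal (τ ^ m) =
              ENNReal.ofReal (τ ^ (2 * m)) ^ (1 / 2 : ℝ) := by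
            rw [ENNReal.ofReal_rpow_of_nonneg (pow_nonneg hτ.1.le _) (by norm_num),
              ← Real.sqrt_eq_rpow, mul_comm, pow_mul, Real.sqrt_sq (pow_nonneg hτ.1.le _)]
          rw [h1, ← ENNReal.mul_rpow_of_nonneg _ _ (by norm_num),
            ← ENNReal.ofReal_mul (pow_nonneg hτ.1.le _)]
          refine ENNReal.rpow_le_one ?_ (by norm_num)
          rw [ENNReal.ofReal_le_one, inv_pow, ← div_eq_mul_inv,
            div_le_one (pow_pos hτ.1 _)]
          exact pow_le_pow_of_le_one hτ.1.le hτ.2 hm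
      _ = _ := by simp
  calc ‖iteratedFDeriv ℝ k u p‖ₑ * μ B = ∫⁻ _ in B, ‖iteratedFDeriv ℝ k u p‖ₑ ∂μ := by simp
    _ ≤ ∫⁻ y in B, (∑ i ∈ Finset.range (m + 1),
          (L : ENNReal) ^ i * ‖iteratedFDeriv ℝ (k + i) u (p + (1 : ℝ) • (y - p))‖ₑ +
        L ^ (m + 1) * ∫⁻ τ in Set.Ioc (0 : ℝ) 1, ENNReal.ofReal (τ ^ m) *
          ‖iteratedFDeriv ℝ (k + (m + 1)) u (p + τ • (y - p))‖ₑ) ∂μ := by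
        refine setLIntegral_mono' hB fun y hy => ?_
        simpa only [one_smul] using enorm_iteratedFDeriv_le_along_segment hu k m (hL y hy)
    _ = ∑ i ∈ Finset.range (m + 1), (L : ENNReal) ^ i *
          ∫⁻ y in B, ‖iteratedFDeriv ℝ (k + i) u (p + (1 : ℝ) • (y - p))‖ₑ ∂μ +
        L ^ (m + 1) * ∫⁻ y in B, ∫⁻ τ in Set.Ioc (0 : ℝ) 1, ENNReal.ofReal (τ ^ m) *
          ‖iteratedFDeriv ℝ (k + (m + 1)) u (p + τ • (y - p))‖ₑ ∂volume ∂μ := by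
        have hm1 : ∀ i, Measurable fun y =>
            ‖iteratedFDeriv ℝ (k + i) u (p + (1 : ℝ) • (y - p))‖ₑ := fun i =>
          (hmeas _).comp (by fun_prop)
        rw [lintegral_add_left (Finset.measurable_fun_sum _ fun i _ => (hm1 i).const_mul _),
          lintegral_finsetSum _ fun i _ => (hm1 i).const_mul _,
          lintegral_const_mul' _ _ (by finiteness)]
        congr 1
        exact Finset.sum_congr rfl fun i _ => lintegral_const_mul' _ _ (by finiteness)
    _ ≤ ∑ i ∈ Finset.range (m + 1), (L : ENNReal) ^ i * (μ B ^ (1 / 2 : ℝ) *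
          (∫⁻ z in S, ‖iteratedFDeriv ℝ (k + i) u z‖ₑ ^ 2 ∂μ) ^ (1 / 2 : ℝ)) +
        L ^ (m + 1) * (μ B ^ (1 / 2 : ℝ) *
          (∫⁻ z in S, ‖iteratedFDeriv ℝ (k + (m + 1)) u z‖ₑ ^ 2 ∂μ) ^ (1 / 2 : ℝ)) := by
        gcongr with i hi
        simpa using hE (k + i) 1 (by simp)
    _ = _ := by
        rw [Finset.sum_range_succ _ (m + 1), mul_add, Finset.mul_sum]
        simp only [mul_left_comm]

theorem sqrt_one_add_norm_sq_le_add {E : Type*} [NormedAddCommGroup E] {x y : E} {h : ℝ}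
    (hxy : ‖y - x‖ ≤ h) : √(1 + ‖x‖ ^ 2) ≤ √(1 + ‖y‖ ^ 2) + h := by
  have h0 : 0 ≤ h := (norm_nonneg _).trans hxy
  have h1 : ‖x‖ ≤ ‖y‖ + h := by
    have := norm_sub_norm_le x y
    rw [norm_sub_rev] at this
    linarith
  have h2 : ‖y‖ ≤ √(1 + ‖y‖ ^ 2) := Real.le_sqrt_of_sq_le (by linarith)
  refine Real.sqrt_le_iff.2 ⟨by positivity, ?_⟩
  nlinarith [Real.sq_sqrt (by positivity : (0 : ℝ) ≤ 1 + ‖y‖ ^ 2), norm_nonneg x, norm_nonneg y]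

theorem segment_mem_boostRegion {n : ℕ} {θ : ℝ} (hθ : θ ∈ Set.Ioc (0 : ℝ) 1)
    {p y : EuclideanSpace ℝ (Fin n) × ℝ} (hp : p ∈ boostRegion n θ)
    (hy : y ∈ Metric.closedBall (p.1, (0 : ℝ)) (θ * √(1 + ‖p.1‖ ^ 2) / 4))
    {τ : ℝ} (hτ : τ ∈ Set.Ioc (0 : ℝ) 1) :
    p + τ • (y - p) ∈ boostRegion n θ ∩ {z | ‖z.1 - p.1‖ ≤ √(1 + ‖p.1‖ ^ 2) / 4} := by
  obtain ⟨hθ0, hθ1⟩ := hθ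
  obtain ⟨hτ0, hτ1⟩ := hτ
  set R := √(1 + ‖p.1‖ ^ 2) with hR
  have hR0 : 0 < R := Real.sqrt_pos.2 (by positivity)
  rw [mem_closedBall_iff_norm, Prod.norm_def, max_le_iff] at hy
  obtain ⟨hy1, hy2⟩ := hy
  simp only [Prod.fst_sub, Prod.snd_sub, sub_zero, Real.norm_eq_abs] at hy1 hy2
  have hp' : |p.2| ≤ θ * R := hp
  have hz : ‖(p + τ • (y - p)).1 - p.1‖ ≤ τ * (θ * R / 4) := by
    simp only [Prod.fst_add, Prod.smul_fst, Prod.fst_sub, add_sub_cancel_left, norm_smul,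
      Real.norm_eq_abs, abs_of_pos hτ0]
    gcongr
  have hθR : θ * R ≤ R := mul_le_of_le_one_left hR0.le hθ1
  have hτR : τ * (θ * R) ≤ θ * R := mul_le_of_le_one_left (by positivity) hτ1
  refine ⟨?_, by simp only [Set.mem_ofPred_eq]; linarith⟩
  have h1 := sqrt_one_add_norm_sq_le_add hz
  simp only [boostRegion, Set.mem_ofPred_eq]
  calc |(p + τ • (y - p)).2| = |(1 - τ) * p.2 + τ * y.2| := by
        simp only [Prod.snd_add, Prod.smul_snd, Prod.snd_sub, smul_eq_mul]; congr 1; ring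
    _ ≤ (1 - τ) * |p.2| + τ * |y.2| := by
        refine (abs_add_le _ _).trans_eq ?_
        rw [abs_mul, abs_mul, abs_of_pos hτ0, abs_of_nonneg (by linarith : 0 ≤ 1 - τ)]
    _ ≤ (1 - τ) * (θ * R) + τ * (θ * R / 4) := by
        have : 0 ≤ 1 - τ := by linarith
        gcongr
    _ ≤ θ * (R - τ * (θ * R / 4)) := by
        have : θ * (τ * (θ * R)) ≤ 1 * (τ * (θ * R)) := by gcongr
        have : 0 ≤ τ * (θ * R) := by positivity
        linarith
    _ ≤ _ := by gcongr; linarith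

theorem rpow_le_four_rpow_mul_rpow {a b x y : ℝ} (hab : |a| ≤ b) (hx : 0 < x) (hy : 0 < y)
    (hxy : x ≤ 4 * y) (hyx : y ≤ 4 * x) : x ^ a ≤ 4 ^ b * y ^ a := by
  have h : x ^ a ≤ 4 ^ |a| * y ^ a := by
    rcases le_total 0 a with ha | ha
    · rw [abs_of_nonneg ha, ← Real.mul_rpow (by norm_num) hy.le]
      gcongr
    · have h1 := Real.rpow_le_rpow_of_nonpos (by positivity) (by linarith : y / 4 ≤ x) ha
      rwa [Real.div_rpow hy.le (by norm_num), div_eq_mul_inv, ← Real.rpow_neg (by norm_num),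
        mul_comm, ← abs_of_nonpos ha] at h1
  refine h.trans ?_
  gcongr
  norm_num

theorem one_add_norm_sq_comparable {E : Type*} [NormedAddCommGroup E] {x z : E}
    (h : ‖z - x‖ ≤ √(1 + ‖x‖ ^ 2) / 4) :
    1 + ‖x‖ ^ 2 ≤ 4 * (1 + ‖z‖ ^ 2) ∧ 1 + ‖z‖ ^ 2 ≤ 4 * (1 + ‖x‖ ^ 2) := by
  have h1 := sqrt_one_add_norm_sq_le_add h
  have h2 := sqrt_one_add_norm_sq_le_add ((norm_sub_rev x z).trans_le h)
  have hx := Real.sq_sqrt (by positivity : (0 : ℝ) ≤ 1 + ‖x‖ ^ 2)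
  have hz := Real.sq_sqrt (by positivity : (0 : ℝ) ≤ 1 + ‖z‖ ^ 2)
  have hx0 := Real.sqrt_nonneg (1 + ‖x‖ ^ 2)
  have hz0 := Real.sqrt_nonneg (1 + ‖z‖ ^ 2)
  constructor <;> nlinarith

theorem measurableSet_boostRegion (n : ℕ) (θ : ℝ) : MeasurableSet (boostRegion n θ) :=
  (isClosed_le (by fun_prop) (by fun_prop)).measurableSet

/-- Near `p` the weight is comparable to its value at `p`, so that the weighted norm controls the
`L²` norm of each derivative. -/
theorem sqrt_setLIntegral_le_wSobOn {n s j : ℕ} (hj : j ≤ s) {δ b : ℝ} (hb : |δ + j| ≤ b)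
    (U : Set (EuclideanSpace ℝ (Fin n) × ℝ)) (hU : MeasurableSet U)
    (u : EuclideanSpace ℝ (Fin n) × ℝ → ℝ) (p : EuclideanSpace ℝ (Fin n) × ℝ) :
    (∫⁻ z in U ∩ {z | ‖z.1 - p.1‖ ≤ √(1 + ‖p.1‖ ^ 2) / 4},
        ‖iteratedFDeriv ℝ j u z‖ₑ ^ 2) ^ (1 / 2 : ℝ) ≤
      ENNReal.ofReal (2 ^ b * √(1 + ‖p.1‖ ^ 2) ^ (-(δ + j))) * wSobOn n s δ U u := by
  set S := U ∩ {z : EuclideanSpace ℝ (Fin n) × ℝ | ‖z.1 - p.1‖ ≤ √(1 + ‖p.1‖ ^ 2) / 4}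
  have hS : MeasurableSet S :=
    hU.inter (isClosed_le (by fun_prop) (by fun_prop)).measurableSet
  set Q := 1 + ‖p.1‖ ^ 2 with hQ
  have hQ0 : 0 < Q := by positivity
  have h1 : ∫⁻ z in S, ‖iteratedFDeriv ℝ j u z‖ₑ ^ 2 ≤ ENNReal.ofReal (4 ^ b * Q ^ (-(δ + j))) *
      ∑ k ∈ Finset.range (s + 1), ∫⁻ p in U,
        ENNReal.ofReal ((1 + ‖p.1‖ ^ 2) ^ (δ + (k : ℝ)) * ‖iteratedFDeriv ℝ k u p‖ ^ 2) := by
    refine le_trans ?_ (mul_le_mul_right (Finset.single_le_sum (fun _ _ => zero_le)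
      (Finset.mem_range.2 (Nat.lt_succ_of_le hj))) _)
    refine le_trans ?_ (mul_le_mul_right (lintegral_mono_set (Set.inter_subset_left : S ⊆ U)) _)
    rw [← lintegral_const_mul' _ _ (by finiteness)]
    refine setLIntegral_mono' hS fun z hz => ?_
    obtain ⟨hz1, hz2⟩ := one_add_norm_sq_comparable hz.2
    have := rpow_le_four_rpow_mul_rpow hb hQ0 (by positivity) hz1 hz2
    rw [← ofReal_norm, ← ENNReal.ofReal_pow (norm_nonneg _), ← ENNReal.ofReal_mul (by positivity)]
    refine ENNReal.ofReal_le_ofReal ?_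
    rw [← mul_assoc]
    refine le_mul_of_one_le_left (by positivity) ?_
    rw [Real.rpow_neg hQ0.le, mul_right_comm, ← div_eq_mul_inv, one_le_div (by positivity)]
    exact this
  refine (ENNReal.rpow_le_rpow h1 (by norm_num)).trans_eq ?_
  rw [ENNReal.mul_rpow_of_nonneg _ _ (by norm_num), wSobOn,
    ENNReal.ofReal_rpow_of_nonneg (by positivity) (by norm_num)]
  congr 2
  rw [Real.mul_rpow (by positivity) (by positivity), Real.sqrt_eq_rpow, ← Real.rpow_mul hQ0.le,
    ← Real.rpow_mul hQ0.le, ← Real.rpow_mul (by norm_num), mul_comm (-(δ + (j : ℝ))),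
    mul_comm b, Real.rpow_mul (by norm_num)]
  congr 2
  rw [← Real.sqrt_eq_rpow, show (4 : ℝ) = 2 ^ 2 by norm_num, Real.sqrt_sq (by norm_num)]

/-- **Weighted Sobolev embedding on the boost region**: if `s′ < s − (n+1)/2` and
`δ′ < δ + (n+1)/2`, there is `C = C(n, θ, s, s′, δ, δ′)` such that every smooth `u` with
finite `H_{s+1,δ}(Ω_θ)`-norm satisfies `σ(x)^{δ′+k} ‖Dᵏu(x,t)‖ ≤ C ‖u‖_{H_{s+1,δ}(Ω_θ)}`
for all `0 ≤ k ≤ s′` and `(x,t) ∈ Ω_θ`. -/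
theorem weighted_sobolev_embedding_boost
    (n : ℕ) (hn : 1 ≤ n) (θ : ℝ) (hθ : θ ∈ Set.Ioc (0 : ℝ) 1)
    (s s' : ℕ) (δ δ' : ℝ)
    (hs : (s' : ℝ) < (s : ℝ) - (n + 1) / 2) (hδ : δ' < δ + (n + 1) / 2) :
    ∃ C : ℝ, 0 < C ∧
      ∀ u : EuclideanSpace ℝ (Fin n) × ℝ → ℝ, ContDiff ℝ (⊤ : ℕ∞) u →
        wSobOn n (s + 1) δ (boostRegion n θ) u < ⊤ →
        ∀ k : ℕ, k ≤ s' → ∀ p ∈ boostRegion n θ,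
          ENNReal.ofReal ((1 + ‖p.1‖ ^ 2) ^ ((δ' + (k : ℝ)) / 2) * ‖iteratedFDeriv ℝ k u p‖)
            ≤ ENNReal.ofReal C * wSobOn n (s + 1) δ (boostRegion n θ) u := by
  have hd : s' ≤ s ∧ n + 1 ≤ 2 * (s - s') := by
    have h1 : ((2 * s' + (n + 1) : ℕ) : ℝ) < ((2 * s : ℕ) : ℝ) := by push_cast; linarith
    have h2 : 2 * s' + (n + 1) < 2 * s := by exact_mod_cast h1
    omega
  have hHaar : (volume : Measure (EuclideanSpace ℝ (Fin n) × ℝ)).IsAddHaarMeasure :=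
    inferInstanceAs (Measure.prod volume volume).IsAddHaarMeasure
  set b : ℝ := |δ| + (s + 1) with hb
  set ω : ℝ := (volume (Metric.ball (0 : EuclideanSpace ℝ (Fin n) × ℝ) 1)).toReal with hω
  have hω0 : 0 < ω := ENNReal.toReal_pos
    (Metric.measure_ball_pos _ _ one_pos).ne' measure_ball_lt_top.ne
  have hfin : Module.finrank ℝ (EuclideanSpace ℝ (Fin n) × ℝ) = n + 1 := by simp
  set β : ℝ := (θ / 4) ^ (n + 1) * ω with hβ
  have hθ0 := hθ.1
  have hβ0 : 0 < β := by positivity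
  refine ⟨2 ^ b * 2 ^ (s + 2) / √β, by positivity, fun u hu hN k hk p hp => ?_⟩
  set N := wSobOn n (s + 1) δ (boostRegion n θ) u
  set R := √(1 + ‖p.1‖ ^ 2) with hR
  have hR1 : 1 ≤ R := Real.one_le_sqrt.2 (by nlinarith [sq_nonneg ‖p.1‖])
  have hR0 : 0 < R := by linarith
  set B := Metric.closedBall (p.1, (0 : ℝ)) (θ * R / 4)
  have hvol : volume B = ENNReal.ofReal (β * R ^ (n + 1)) := by
    rw [Measure.addHaar_closedBall _ _ (by positivity), hfin,
      ← ENNReal.ofReal_toReal (measure_ball_lt_top (μ := volume)).ne, ← hω,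
      ← ENNReal.ofReal_mul (by positivity)]
    congr 1
    rw [hβ, mul_div_right_comm, mul_pow]
    ring
  have hL : ∀ y ∈ B, ‖y - p‖₊ ≤ Real.toNNReal (2 * R) := by
    intro y hy
    rw [← norm_toNNReal]
    refine Real.toNNReal_le_toNNReal ?_
    have h1 : ‖y - (p.1, 0)‖ ≤ θ * R / 4 := mem_closedBall_iff_norm.1 hy
    have h2 : ‖(p.1, (0 : ℝ)) - p‖ ≤ θ * R := by
      rw [Prod.norm_def]
      simpa using (show |p.2| ≤ θ * R from hp)
    have h3 : θ * R ≤ R := mul_le_of_le_one_left hR0.le hθ.2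
    linarith [norm_sub_le_norm_sub_add_norm_sub y (p.1, (0 : ℝ)) p]
  have hS : MeasurableSet (boostRegion n θ ∩
      {z : EuclideanSpace ℝ (Fin n) × ℝ | ‖z.1 - p.1‖ ≤ R / 4}) :=
    (measurableSet_boostRegion n θ).inter
      (isClosed_le (by fun_prop) (by fun_prop)).measurableSet
  have hmain := enorm_iteratedFDeriv_mul_measure_le volume hu k (s - k) (by rw [hfin]; omega)
    Metric.isClosed_closedBall.measurableSet hS hL
    (fun τ hτ y hy => segment_mem_boostRegion hθ hp hy hτ)
  have hsum : ∑ i ∈ Finset.range (s - k + 2), ((2 * R).toNNReal : ENNReal) ^ i *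
      (∫⁻ z in boostRegion n θ ∩
        {z : EuclideanSpace ℝ (Fin n) × ℝ | ‖z.1 - p.1‖ ≤ R / 4},
        ‖iteratedFDeriv ℝ (k + i) u z‖ₑ ^ 2) ^ (1 / 2 : ℝ) ≤
      ENNReal.ofReal (2 ^ b * 2 ^ (s + 2) * R ^ (-(δ + k))) * N := by
    have hterm : ∀ i ∈ Finset.range (s - k + 2), ((2 * R).toNNReal : ENNReal) ^ i *
        (∫⁻ z in boostRegion n θ ∩
          {z : EuclideanSpace ℝ (Fin n) × ℝ | ‖z.1 - p.1‖ ≤ R / 4},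
          ‖iteratedFDeriv ℝ (k + i) u z‖ₑ ^ 2) ^ (1 / 2 : ℝ) ≤
        ENNReal.ofReal (2 ^ b * 2 ^ i * R ^ (-(δ + k))) * N := by
      intro i hi
      have hi' : k + i ≤ s + 1 := by have := Finset.mem_range.1 hi; omega
      have hbi : |δ + ((k + i : ℕ) : ℝ)| ≤ b := by
        refine (abs_add_le _ _).trans ?_
        rw [Nat.abs_cast, hb]
        gcongr
        exact_mod_cast hi'
      refine (mul_le_mul_right (sqrt_setLIntegral_le_wSobOn hi' hbi _
        (measurableSet_boostRegion n θ) u p) _).trans_eq ?_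
      rw [← mul_assoc]
      congr 1
      rw [← ENNReal.ofReal, ← ENNReal.ofReal_pow (by positivity),
        ← ENNReal.ofReal_mul (by positivity)]
      congr 1
      have : R ^ (-(δ + k)) = R ^ i * R ^ (-(δ + ((k + i : ℕ) : ℝ))) := by
        rw [← Real.rpow_natCast, ← Real.rpow_add hR0]
        congr 1; push_cast; ring
      rw [this]
      ring
    refine (Finset.sum_le_sum hterm).trans ?_
    rw [← Finset.sum_mul, ← ENNReal.ofReal_sum_of_nonneg (fun _ _ => by positivity),
      ← Finset.sum_mul, ← Finset.mul_sum]
    gcongr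
    calc ∑ i ∈ Finset.range (s - k + 2), (2 : ℝ) ^ i ≤ ∑ i ∈ Finset.range (s + 2), (2 : ℝ) ^ i :=
          Finset.sum_le_sum_of_subset_of_nonneg
            (Finset.range_mono (by omega)) fun _ _ _ => by positivity
      _ ≤ 2 ^ (s + 2) := by
          rw [geom_sum_eq (by norm_num)]
          norm_num
  have hall := hmain.trans (mul_le_mul_right hsum _)
  rw [hvol, ← ENNReal.ofReal_toReal hN.ne, ← ofReal_norm,
    ENNReal.ofReal_rpow_of_nonneg (by positivity) (by norm_num),
    ← ENNReal.ofReal_mul (norm_nonneg _), ← ENNReal.ofReal_mul (by positivity),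
    ← ENNReal.ofReal_mul (by positivity), ENNReal.ofReal_le_ofReal_iff (by positivity),
    ← Real.sqrt_eq_rpow] at hall
  rw [← ENNReal.ofReal_toReal hN.ne, ← ENNReal.ofReal_mul (by positivity)]
  refine ENNReal.ofReal_le_ofReal ?_
  set D := ‖iteratedFDeriv ℝ k u p‖
  set M := N.toReal
  have hweight : (1 + ‖p.1‖ ^ 2) ^ ((δ' + (k : ℝ)) / 2) = R ^ (δ' + (k : ℝ)) := by
    rw [hR, Real.sqrt_eq_rpow, ← Real.rpow_mul (by positivity)]
    congr 1; ring
  have hsqrt : √(β * R ^ (n + 1)) = √β * R ^ (((n : ℝ) + 1) / 2) := by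
    rw [Real.sqrt_mul hβ0.le, Real.sqrt_eq_rpow (R ^ (n + 1)), ← Real.rpow_natCast,
      ← Real.rpow_mul hR0.le]
    congr 2; push_cast; ring
  have hD : D * (√β * R ^ (((n : ℝ) + 1) / 2)) ≤
      2 ^ b * 2 ^ (s + 2) * R ^ (-(δ + k)) * M := by
    rw [← hsqrt]
    have hpos : 0 < √(β * R ^ (n + 1)) := by positivity
    refine le_of_mul_le_mul_left ?_ hpos
    rwa [mul_left_comm, Real.mul_self_sqrt (by positivity)]
  rw [hweight, div_mul_eq_mul_div, le_div_iff₀ (by positivity)]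
  have hexp : R ^ (δ' + (k : ℝ)) ≤ R ^ (((n : ℝ) + 1) / 2) * R ^ (δ + (k : ℝ)) := by
    rw [← Real.rpow_add hR0]
    exact Real.rpow_le_rpow_of_exponent_le hR1 (by linarith)
  calc R ^ (δ' + (k : ℝ)) * D * √β
      ≤ R ^ (((n : ℝ) + 1) / 2) * R ^ (δ + (k : ℝ)) * D * √β := by gcongr
    _ = R ^ (δ + (k : ℝ)) * (D * (√β * R ^ (((n : ℝ) + 1) / 2))) := by ring
    _ ≤ R ^ (δ + (k : ℝ)) * (2 ^ b * 2 ^ (s + 2) * R ^ (-(δ + k)) * M) := by gcongr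
    _ = 2 ^ b * 2 ^ (s + 2) * M := by
        rw [Real.rpow_neg hR0.le]
        field_simp
end

section
/- Weighted Sobolev multiplication inequality on the boost region: Let n ≥ 1, θ ∈ (0,1], and let Ω_θ = {(x,t) ∈ ℝⁿ×ℝ : |t| ≤ θσ(x)}. Let s, s₁, s₂ ∈ ℕ and δ, δ₁, δ₂ ∈ ℝ satisfy s ≤ s₁, s ≤ s₂, s < s₁ + s₂ − (n+1)/2 and δ < δ₁ + δ₂ + (n+1)/2. Then there is a constant C such that for all smooth f₁, f₂ : Ω_θ → ℝ with ‖f₁‖_{H_{s₁,δ₁}(Ω_θ)} < ∞ and ‖f₂‖_{H_{s₂,δ₂}(Ω_θ)} < ∞, one has ‖f₁·f₂‖_{H_{s,δ}(Ω_θ)} ≤ C ‖f₁‖_{H_{s₁,δ₁}(Ω_θ)} ‖f₂‖_{H_{s₂,δ₂}(Ω_θ)}. In particular, for s > (n+1)/2 and δ > −(n+1)/2 the space is closed under multiplication with the corresponding norm bound. -/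
open MeasureTheory

namespace WeightedSobolev

section

open Set Metric Module
open scoped ENNReal NNReal ContDiff

theorem lintegral_mul_sq_le {α : Type*} [MeasurableSpace α] (μ : Measure α) {f g : α → ℝ≥0∞}
    (hf : AEMeasurable f μ) (hg : AEMeasurable g μ) :
    (∫⁻ x, f x * g x ∂μ) ^ 2 ≤ (∫⁻ x, f x ^ 2 ∂μ) * ∫⁻ x, g x ^ 2 ∂μ := by
  have h := ENNReal.lintegral_mul_le_Lp_mul_Lq μ (p := 2) (q := 2)
    Real.HolderConjugate.two_two hf hg
  calc (∫⁻ x, f x * g x ∂μ) ^ 2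
      ≤ ((∫⁻ x, f x ^ (2 : ℝ) ∂μ) ^ (1 / 2 : ℝ) * (∫⁻ x, g x ^ (2 : ℝ) ∂μ) ^ (1 / 2 : ℝ)) ^ 2 := by
        gcongr; exact h
    _ = _ := by
        rw [mul_pow, ← ENNReal.rpow_natCast, ← ENNReal.rpow_mul, ← ENNReal.rpow_natCast,
          ← ENNReal.rpow_mul]
        norm_num

theorem ennreal_sum_sq_le_card_mul_sum_sq {ι : Type*} (s : Finset ι) (f : ι → ℝ≥0∞) :
    (∑ i ∈ s, f i) ^ 2 ≤ s.card * ∑ i ∈ s, f i ^ 2 := by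
  have h := ENNReal.inner_le_Lp_mul_Lq s (fun _ => 1) f Real.HolderConjugate.two_two
  calc (∑ i ∈ s, f i) ^ 2
      ≤ ((∑ i ∈ s, (1 : ℝ≥0∞) ^ (2 : ℝ)) ^ (1 / 2 : ℝ) *
          (∑ i ∈ s, f i ^ (2 : ℝ)) ^ (1 / 2 : ℝ)) ^ 2 := by
        gcongr; simpa using h
    _ = _ := by
        rw [mul_pow, ← ENNReal.rpow_natCast, ← ENNReal.rpow_mul, ← ENNReal.rpow_natCast,
          ← ENNReal.rpow_mul]
        norm_num

theorem lintegral_Ioo_rpow_lt_top {c : ℝ} (hc : -1 < c) :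
    ∫⁻ t in Ioo (0 : ℝ) 1, ENNReal.ofReal (t ^ c) < ⊤ := by
  have h : IntegrableOn (fun t : ℝ => t ^ c) (Ioo 0 1) :=
    (intervalIntegral.integrableOn_Ioo_rpow_iff one_pos).2 hc
  exact h.lintegral_lt_top

theorem norm_iteratedFDeriv_iteratedFDeriv {E F : Type*} [NormedAddCommGroup E] [NormedSpace ℝ E]
    [NormedAddCommGroup F] [NormedSpace ℝ F] (f : E → F) (j k : ℕ) (x : E) :
    ‖iteratedFDeriv ℝ k (iteratedFDeriv ℝ j f) x‖ = ‖iteratedFDeriv ℝ (k + j) f x‖ := by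
  induction j generalizing k with
  | zero =>
    rw [iteratedFDeriv_zero_eq_comp, LinearIsometryEquiv.norm_iteratedFDeriv_comp_left]
    rfl
  | succ j ih =>
    let e : (E →L[ℝ] (E [×j]→L[ℝ] F)) ≃ₗᵢ[ℝ] (E [×(j + 1)]→L[ℝ] F) :=
      (continuousMultilinearCurryLeftEquiv ℝ (fun _ : Fin (j + 1) => E) F).symm
    have h : iteratedFDeriv ℝ (j + 1) f = e ∘ fderiv ℝ (iteratedFDeriv ℝ j f) := rfl
    have h' := LinearIsometryEquiv.norm_iteratedFDeriv_comp_left (𝕜 := ℝ)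
      (F := E →L[ℝ] (E [×j]→L[ℝ] F)) (G := E [×(j + 1)]→L[ℝ] F) e
      (fderiv ℝ (iteratedFDeriv ℝ j f)) x k
    rw [h, h', norm_iteratedFDeriv_fderiv, ih, show k + 1 + j = k + (j + 1) by omega]

theorem norm_iteratedFDeriv_comp_add_smul_le {E F : Type*} [NormedAddCommGroup E]
    [NormedSpace ℝ E] [NormedAddCommGroup F] [NormedSpace ℝ F] {f : E → F}
    (hf : ContDiff ℝ ∞ f) (p v : E) (k : ℕ) (t : ℝ) :
    ‖iteratedFDeriv ℝ k (fun t : ℝ => f (p + t • v)) t‖ ≤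
      ‖v‖ ^ k * ‖iteratedFDeriv ℝ k f (p + t • v)‖ := by
  have h : (fun t : ℝ => f (p + t • v)) =
      (fun y => f (p + y)) ∘ (ContinuousLinearMap.toSpanSingleton ℝ v) := by
    ext t; simp
  rw [h, ContinuousLinearMap.iteratedFDeriv_comp_right _ (n := ∞) (by fun_prop) _
    (by exact_mod_cast le_top), iteratedFDeriv_comp_add_left]
  refine (ContinuousMultilinearMap.norm_compContinuousLinearMap_le _ _).trans ?_
  simp [mul_comm]

theorem exists_smooth_cutoff_unitInterval : ∃ χ : ℝ → ℝ, ContDiff ℝ ∞ χ ∧ χ 0 = 1 ∧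
    χ =ᶠ[nhds 1] 0 := by
  refine ⟨fun t => Real.smoothTransition (1 - 2 * t), ?_, ?_, ?_⟩
  · exact Real.smoothTransition.contDiff.comp (by fun_prop)
  · simp
  · filter_upwards [Ioi_mem_nhds (show (1 / 2 : ℝ) < 1 by norm_num)] with t ht
    apply Real.smoothTransition.zero_of_nonpos
    simp at ht
    linarith

theorem exists_norm_le_integral_norm_iteratedFDeriv (F : Type*) [NormedAddCommGroup F]
    [NormedSpace ℝ F] [CompleteSpace F] (a : ℕ) : ∃ M : ℝ≥0, ∀ φ : ℝ → F, ContDiff ℝ ∞ φ →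
      ‖φ 0‖ₑ ≤ M * ∫⁻ t in Ioo (0 : ℝ) 1, ENNReal.ofReal (t ^ (a : ℝ)) *
        ∑ k ∈ Finset.range (a + 2), ‖iteratedFDeriv ℝ k φ t‖ₑ := by
  obtain ⟨χ, hχ, hχ0, hχ1⟩ := exists_smooth_cutoff_unitInterval
  have hb : ∀ i : ℕ, ∃ K : ℝ, ∀ t ∈ Icc (0 : ℝ) 1, ‖iteratedFDeriv ℝ i χ t‖ ≤ K := fun i =>
    isCompact_Icc.exists_bound_of_continuousOn
      (hχ.continuous_iteratedFDeriv (by exact_mod_cast le_top)).continuousOn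
  choose K hK using hb
  have hK0 : ∀ i, 0 ≤ K i := fun i => (norm_nonneg _).trans (hK i 0 (by simp))
  refine ⟨(∑ i ∈ Finset.range (a + 2), ((a + 1).choose i : ℝ) * K i).toNNReal, fun φ hφ => ?_⟩
  set M : ℝ := ∑ i ∈ Finset.range (a + 2), ((a + 1).choose i : ℝ) * K i
  set ψ : ℝ → F := fun t => χ t • φ t
  have hψ : ContDiff ℝ ∞ ψ := hχ.smul hφ
  have hψ0 : ψ 0 = φ 0 := by simp [ψ, hχ0]
  have hψ1 : ψ =ᶠ[nhds 1] 0 := by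
    filter_upwards [hχ1] with t ht
    simp [ψ, ht]
  have hT := map_add_eq_sum_add_integral_iteratedFDeriv (f := ψ) (x := 1) (y := -1) (n := a)
    (fun t _ => hψ.contDiffAt.of_le (by exact_mod_cast le_top))
  have hsum : ∑ k ∈ Finset.range (a + 1),
      ((k.factorial : ℝ))⁻¹ • (iteratedFDeriv ℝ k ψ 1 (fun _ => -1)) = 0 := by
    refine Finset.sum_eq_zero fun k _ => ?_
    have : iteratedFDeriv ℝ k ψ 1 = 0 := by
      rw [(hψ1.iteratedFDeriv ℝ k).eq_of_nhds]
      simp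
    simp [this]
  set G : ℝ → F := fun t => t ^ a • iteratedFDeriv ℝ (a + 1) ψ t (fun _ => -1)
  have hint : ∫ t in (0 : ℝ)..1, (1 - t) ^ a • iteratedFDeriv ℝ (a + 1) ψ (1 + t • (-1))
      (fun _ => -1) = ∫ t in (0 : ℝ)..1, G t := by
    have := intervalIntegral.integral_comp_sub_left (a := 0) (b := 1) G 1
    simp only [sub_self, sub_zero] at this
    rw [← this]
    simp [G, sub_eq_add_neg]
  rw [hsum, hint, zero_add, add_neg_cancel, hψ0] at hT
  have hG : ∀ t ∈ Ioc (0 : ℝ) 1, ‖G t‖ₑ ≤ ENNReal.ofReal M * (ENNReal.ofReal (t ^ (a : ℝ)) *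
        ∑ k ∈ Finset.range (a + 2), ‖iteratedFDeriv ℝ k φ t‖ₑ) := by
    intro t ht
    have h1 : ‖G t‖ ≤ M * (t ^ (a : ℝ) *
        ∑ k ∈ Finset.range (a + 2), ‖iteratedFDeriv ℝ k φ t‖) := by
      have h2 : ‖iteratedFDeriv ℝ (a + 1) ψ t (fun _ => -1)‖ ≤ ‖iteratedFDeriv ℝ (a + 1) ψ t‖ := by
        refine (ContinuousMultilinearMap.le_opNorm _ _).trans ?_
        simp
      have h3 : ‖iteratedFDeriv ℝ (a + 1) ψ t‖ ≤ M *
          ∑ k ∈ Finset.range (a + 2), ‖iteratedFDeriv ℝ k φ t‖ := by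
        refine (norm_iteratedFDeriv_smul_le hχ hφ t (by exact_mod_cast le_top)).trans ?_
        rw [Finset.sum_mul]
        refine Finset.sum_le_sum fun i hi => ?_
        gcongr
        · exact mul_nonneg (by positivity) (hK0 i)
        · exact hK i t ⟨ht.1.le, ht.2⟩
        · exact Finset.single_le_sum (f := fun k => ‖iteratedFDeriv ℝ k φ t‖)
            (fun _ _ => norm_nonneg _) (Finset.mem_range.2 (by omega))
      have : ‖G t‖ = t ^ a * ‖iteratedFDeriv ℝ (a + 1) ψ t (fun _ => -1)‖ := by
        simp [G, norm_smul, abs_of_pos ht.1]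
      rw [this, Real.rpow_natCast]
      have := pow_nonneg ht.1.le a
      calc _ ≤ t ^ a * (M * ∑ k ∈ Finset.range (a + 2), ‖iteratedFDeriv ℝ k φ t‖) := by
            gcongr; exact h2.trans h3
        _ = _ := by ring
    have hM : 0 ≤ M := Finset.sum_nonneg fun i _ => mul_nonneg (by positivity) (hK0 i)
    rw [← ofReal_norm]
    refine (ENNReal.ofReal_le_ofReal h1).trans (le_of_eq ?_)
    rw [ENNReal.ofReal_mul hM, ENNReal.ofReal_mul (Real.rpow_nonneg ht.1.le _),
      ENNReal.ofReal_sum_of_nonneg (fun _ _ => norm_nonneg _)]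
    simp only [ofReal_norm]
  calc ‖φ 0‖ₑ ≤ ‖∫ t in (0 : ℝ)..1, G t‖ₑ := by
        rw [hT, enorm_smul]
        refine mul_le_of_le_one_left (zero_le) ?_
        rw [← ofReal_norm, ENNReal.ofReal_le_one]
        simp only [norm_inv, RCLike.norm_natCast]
        exact inv_le_one_of_one_le₀ (by exact_mod_cast Nat.one_le_iff_ne_zero.2 (Nat.factorial_ne_zero a))
    _ ≤ ∫⁻ t in Ioc (0 : ℝ) 1, ‖G t‖ₑ := by
        rw [intervalIntegral.integral_of_le zero_le_one]
        exact enorm_integral_le_lintegral_enorm _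
    _ ≤ ∫⁻ t in Ioc (0 : ℝ) 1, ENNReal.ofReal M * (ENNReal.ofReal (t ^ (a : ℝ)) *
        ∑ k ∈ Finset.range (a + 2), ‖iteratedFDeriv ℝ k φ t‖ₑ) :=
        setLIntegral_mono' measurableSet_Ioc hG
    _ = _ := by
        rw [lintegral_const_mul' _ _ ENNReal.ofReal_ne_top, restrict_Ioo_eq_restrict_Ioc]
        rfl

theorem exists_enorm_sq_le_lintegral_rpow_mul (F : Type*) [NormedAddCommGroup F]
    [NormedSpace ℝ F] [CompleteSpace F] (a : ℕ) {m : ℝ} (hm : m < 2 * a + 1) :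
    ∃ C : ℝ≥0, ∀ φ : ℝ → F, ContDiff ℝ ∞ φ →
      ‖φ 0‖ₑ ^ 2 ≤ C * ∫⁻ t in Ioo (0 : ℝ) 1, ENNReal.ofReal (t ^ m) *
        ∑ k ∈ Finset.range (a + 2), ‖iteratedFDeriv ℝ k φ t‖ₑ ^ 2 := by
  obtain ⟨M, hM⟩ := exists_norm_le_integral_norm_iteratedFDeriv F a
  have hfin : ∫⁻ t in Ioo (0 : ℝ) 1, ENNReal.ofReal (t ^ (2 * a - m)) ≠ ⊤ :=
    (lintegral_Ioo_rpow_lt_top (by linarith)).ne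
  refine ⟨M ^ 2 * (∫⁻ t in Ioo (0 : ℝ) 1, ENNReal.ofReal (t ^ (2 * a - m))).toNNReal *
    (a + 2 : ℕ), fun φ hφ => ?_⟩
  have hc : ∀ k, Continuous (iteratedFDeriv ℝ k φ) := fun k =>
    hφ.continuous_iteratedFDeriv (by exact_mod_cast le_top)
  have hS : Measurable fun t => ∑ k ∈ Finset.range (a + 2), ‖iteratedFDeriv ℝ k φ t‖ₑ :=
    Finset.measurable_fun_sum _ fun k _ => (hc k).enorm.measurable
  have hr : ∀ c : ℝ, Measurable fun t : ℝ => ENNReal.ofReal (t ^ c) := fun c => by fun_prop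
  calc ‖φ 0‖ₑ ^ 2 ≤ (M * ∫⁻ t in Ioo (0 : ℝ) 1, ENNReal.ofReal (t ^ (a : ℝ)) *
        ∑ k ∈ Finset.range (a + 2), ‖iteratedFDeriv ℝ k φ t‖ₑ) ^ 2 := by
        gcongr; exact hM φ hφ
    _ = M ^ 2 * (∫⁻ t in Ioo (0 : ℝ) 1, ENNReal.ofReal (t ^ (a - m / 2)) *
        (ENNReal.ofReal (t ^ (m / 2)) *
          ∑ k ∈ Finset.range (a + 2), ‖iteratedFDeriv ℝ k φ t‖ₑ)) ^ 2 := by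
        rw [mul_pow]
        congr 2
        refine setLIntegral_congr_fun measurableSet_Ioo fun t ht => ?_
        rw [← mul_assoc, ← ENNReal.ofReal_mul (Real.rpow_nonneg ht.1.le _),
          ← Real.rpow_add ht.1, sub_add_cancel]
    _ ≤ M ^ 2 * ((∫⁻ t in Ioo (0 : ℝ) 1, ENNReal.ofReal (t ^ (a - m / 2)) ^ 2) *
        ∫⁻ t in Ioo (0 : ℝ) 1, (ENNReal.ofReal (t ^ (m / 2)) *
          ∑ k ∈ Finset.range (a + 2), ‖iteratedFDeriv ℝ k φ t‖ₑ) ^ 2) := by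
        gcongr
        exact lintegral_mul_sq_le _ (hr _).aemeasurable ((hr _).mul hS).aemeasurable
    _ ≤ M ^ 2 * ((∫⁻ t in Ioo (0 : ℝ) 1, ENNReal.ofReal (t ^ (2 * a - m))) *
        ∫⁻ t in Ioo (0 : ℝ) 1, (a + 2 : ℕ) * (ENNReal.ofReal (t ^ m) *
          ∑ k ∈ Finset.range (a + 2), ‖iteratedFDeriv ℝ k φ t‖ₑ ^ 2)) := by
        refine mul_le_mul_right (mul_le_mul' ?_ ?_) _
        · refine setLIntegral_mono' measurableSet_Ioo fun t ht => ?_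
          rw [← ENNReal.ofReal_pow (Real.rpow_nonneg ht.1.le _), ← Real.rpow_mul_natCast ht.1.le]
          refine le_of_eq ?_
          congr 2
          push_cast
          ring
        · refine setLIntegral_mono' measurableSet_Ioo fun t ht => ?_
          rw [mul_pow, ← ENNReal.ofReal_pow (Real.rpow_nonneg ht.1.le _),
            ← Real.rpow_mul_natCast ht.1.le]
          have := ennreal_sum_sq_le_card_mul_sum_sq (Finset.range (a + 2))
            (fun k => ‖iteratedFDeriv ℝ k φ t‖ₑ)
          rw [Finset.card_range] at this
          calc _ ≤ ENNReal.ofReal (t ^ (m / 2 * (2 : ℕ))) * ((a + 2 : ℕ) *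
                ∑ k ∈ Finset.range (a + 2), ‖iteratedFDeriv ℝ k φ t‖ₑ ^ 2) := by gcongr
            _ = _ := by
              push_cast
              rw [div_mul_cancel₀ _ (two_ne_zero)]
              ring
    _ = _ := by
        rw [lintegral_const_mul' _ _ (ENNReal.natCast_ne_top _)]
        push_cast
        rw [ENNReal.coe_toNNReal hfin]
        ring

section BallAverage

variable {E : Type*} [NormedAddCommGroup E] [NormedSpace ℝ E] [FiniteDimensional ℝ E]
  [MeasurableSpace E] [BorelSpace E] (μ : Measure E) [μ.IsAddHaarMeasure] {σ : E → ℝ}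

/-- The integral of `F` over the ball of radius `τσ(p)/2` about `p`, normalised by
`(τσ(p))^{dim E}`. -/
noncomputable def ballAvg (σ : E → ℝ) (F : E → ℝ≥0∞) (τ : ℝ) (p : E) : ℝ≥0∞ :=
  ENNReal.ofReal ((τ * σ p) ^ finrank ℝ E)⁻¹ * ∫⁻ y in closedBall p (τ * σ p / 2), F y ∂μ

theorem measurable_setLIntegral_closedBall (hσ : Continuous σ) {F : E → ℝ≥0∞}
    (hF : Measurable F) :
    Measurable fun q : E × ℝ => ∫⁻ y in closedBall q.1 (q.2 * σ q.1 / 2), F y ∂μ := by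
  have : ProperSpace E := FiniteDimensional.proper ℝ E
  have hs : MeasurableSet {z : (E × ℝ) × E | dist z.2 z.1.1 ≤ z.1.2 * σ z.1.1 / 2} :=
    (isClosed_le (by fun_prop) (by fun_prop)).measurableSet
  have h : Measurable fun z : (E × ℝ) × E =>
      {z : (E × ℝ) × E | dist z.2 z.1.1 ≤ z.1.2 * σ z.1.1 / 2}.indicator (fun z => F z.2) z :=
    (hF.comp measurable_snd).indicator hs
  convert h.lintegral_prod_right' (ν := μ) using 2 with q
  rw [← lintegral_indicator measurableSet_closedBall]
  rfl

theorem measurable_ballAvg (hσ : Continuous σ) {F : E → ℝ≥0∞} (hF : Measurable F) :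
    Measurable fun q : E × ℝ => ballAvg μ σ F q.2 q.1 := by
  have : ProperSpace E := FiniteDimensional.proper ℝ E
  refine Measurable.mul ?_ (measurable_setLIntegral_closedBall μ hσ hF)
  have : Continuous fun q : E × ℝ => (q.2 * σ q.1) ^ finrank ℝ E := by fun_prop
  exact this.measurable.inv.ennreal_ofReal

omit [FiniteDimensional ℝ E] [BorelSpace E] [μ.IsAddHaarMeasure] in
theorem ofReal_pow_mul_ballAvg_le (F : E → ℝ≥0∞) {τ : ℝ} (hτ : 0 < τ) {p : E} (hp : 0 < σ p) :
    ENNReal.ofReal (σ p ^ finrank ℝ E) * ballAvg μ σ F τ p ≤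
      ENNReal.ofReal (τ ^ finrank ℝ E)⁻¹ * ∫⁻ y, F y ∂μ := by
  rw [ballAvg, ← mul_assoc, ← ENNReal.ofReal_mul (by positivity)]
  have : σ p ^ finrank ℝ E * ((τ * σ p) ^ finrank ℝ E)⁻¹ = (τ ^ finrank ℝ E)⁻¹ := by
    rw [mul_pow]; field_simp
  rw [this]
  exact mul_le_mul_right (setLIntegral_le_lintegral _ _) _

omit [NormedSpace ℝ E] [FiniteDimensional ℝ E] [MeasurableSpace E] [BorelSpace E] in
theorem le_two_mul_of_dist_le (hσ : LipschitzWith 1 σ) {p y : E}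
    (h : dist y p ≤ σ p / 2) : σ p ≤ 2 * σ y ∧ σ y ≤ 2 * σ p := by
  have h1 := hσ.dist_le_mul y p
  rw [Real.dist_eq, NNReal.coe_one, one_mul] at h1
  have h2 := abs_le.1 (h1.trans h)
  have h3 : 0 ≤ σ p := by linarith [dist_nonneg.trans h]
  constructor <;> linarith [h2.1, h2.2]

theorem lintegral_ballAvg_le (hσ : LipschitzWith 1 σ) (hpos : ∀ p, 0 < σ p) {F : E → ℝ≥0∞}
    (hF : Measurable F) {τ : ℝ} (hτ : τ ∈ Ioo (0 : ℝ) 1) :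
    ∫⁻ p, ballAvg μ σ F τ p ∂μ ≤ 2 ^ finrank ℝ E * μ (ball 0 1) * ∫⁻ y, F y ∂μ := by
  have : ProperSpace E := FiniteDimensional.proper ℝ E
  have hσc := hσ.continuous
  have hs : MeasurableSet {z : E × E | dist z.2 z.1 ≤ τ * σ z.1 / 2} :=
    (isClosed_le (by fun_prop) (by fun_prop)).measurableSet
  have hw : Measurable fun p : E => ENNReal.ofReal ((τ * σ p) ^ finrank ℝ E)⁻¹ := by
    have : Continuous fun p : E => (τ * σ p) ^ finrank ℝ E := by fun_prop
    exact this.measurable.inv.ennreal_ofReal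
  calc ∫⁻ p, ballAvg μ σ F τ p ∂μ
      = ∫⁻ p, ∫⁻ y, {z : E × E | dist z.2 z.1 ≤ τ * σ z.1 / 2}.indicator (fun z =>
          ENNReal.ofReal ((τ * σ z.1) ^ finrank ℝ E)⁻¹ * F z.2) (p, y) ∂μ ∂μ := by
        refine lintegral_congr fun p => ?_
        rw [ballAvg, ← lintegral_const_mul _ hF, ← lintegral_indicator measurableSet_closedBall]
        rfl
    _ = ∫⁻ y, ∫⁻ p, {z : E × E | dist z.2 z.1 ≤ τ * σ z.1 / 2}.indicator (fun z =>
          ENNReal.ofReal ((τ * σ z.1) ^ finrank ℝ E)⁻¹ * F z.2) (p, y) ∂μ ∂μ := by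
        apply lintegral_lintegral_swap
        exact (((hw.comp measurable_fst).mul (hF.comp measurable_snd)).indicator hs).aemeasurable
    _ ≤ ∫⁻ y, ∫⁻ p, (closedBall y (τ * σ y)).indicator (fun _ =>
          ENNReal.ofReal ((τ * σ y / 2) ^ finrank ℝ E)⁻¹ * F y) p ∂μ ∂μ := by
        refine lintegral_mono fun y => lintegral_mono fun p => ?_
        refine indicator_le (s := {z : E × E | dist z.2 z.1 ≤ τ * σ z.1 / 2})
          (g := fun z => (closedBall z.2 (τ * σ z.2)).indicator (fun _ =>
          ENNReal.ofReal ((τ * σ z.2 / 2) ^ finrank ℝ E)⁻¹ * F z.2) z.1) ?_ (p, y)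
        rintro ⟨p, y⟩ h
        simp only [mem_ofPred_eq] at h
        have hy := hpos y
        have hτ0 := hτ.1
        have h1 := le_two_mul_of_dist_le hσ (h.trans (by nlinarith [hpos p, hτ.2]))
        have hm : p ∈ closedBall y (τ * σ y) := by
          rw [mem_closedBall, dist_comm]
          nlinarith [hτ.1]
        simp only [indicator_of_mem hm]
        gcongr
        nlinarith [hτ.1]
    _ = ∫⁻ y, 2 ^ finrank ℝ E * μ (ball 0 1) * F y ∂μ := by
        refine lintegral_congr fun y => ?_
        have hy := hpos y
        have hτ0 := hτ.1
        rw [lintegral_indicator measurableSet_closedBall, setLIntegral_const,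
          Measure.addHaar_closedBall _ _ (by positivity), mul_right_comm, ← mul_assoc,
          ← ENNReal.ofReal_mul (by positivity)]
        have : ((τ * σ y / 2) ^ finrank ℝ E)⁻¹ * (τ * σ y) ^ finrank ℝ E = 2 ^ finrank ℝ E := by
          rw [div_pow, inv_div, div_mul_cancel₀]
          positivity
        rw [this, ENNReal.ofReal_pow (by norm_num), ENNReal.ofReal_ofNat]
    _ = _ := lintegral_const_mul _ hF

theorem lintegral_comp_add_smul {G : E → ℝ≥0∞} (hG : Measurable G) (p : E) {c : ℝ} (hc : 0 < c) :
    ∫⁻ w, G (p + c • w) ∂μ = ENNReal.ofReal (c ^ finrank ℝ E)⁻¹ * ∫⁻ y, G y ∂μ := by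
  have h := lintegral_map (μ := μ) (hG.comp (measurable_const_add p)) (measurable_const_smul c)
  rw [Measure.map_addHaar_smul μ hc.ne', lintegral_smul_measure, abs_of_pos (by positivity)] at h
  simp only [Function.comp_apply] at h
  rw [← h, lintegral_add_left_eq_self (μ := μ) G p, smul_eq_mul]

theorem setLIntegral_comp_add_smul_le_ballAvg {F : E → ℝ≥0∞} (hF : Measurable F) {p e : E}
    {r τ : ℝ} (he : ∀ w ∈ closedBall e r, ‖w‖ ≤ 1 / 2) (hτ : 0 < τ) (hp : 0 < σ p) :
    ∫⁻ w in closedBall e r, F (p + (τ * σ p) • w) ∂μ ≤ ballAvg μ σ F τ p := by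
  rw [ballAvg, ← lintegral_indicator (μ := μ) (measurableSet_closedBall (x := p)),
    ← lintegral_comp_add_smul μ (hF.indicator measurableSet_closedBall) p (mul_pos hτ hp),
    ← lintegral_indicator measurableSet_closedBall]
  refine lintegral_mono fun w => ?_
  refine indicator_le (s := closedBall e r)
    (g := fun w => (closedBall p (τ * σ p / 2)).indicator F (p + (τ * σ p) • w)) ?_ w
  intro w hw
  have hm : p + (τ * σ p) • w ∈ closedBall p (τ * σ p / 2) := by
    rw [mem_closedBall, dist_eq_norm, add_sub_cancel_left, norm_smul, Real.norm_eq_abs,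
      abs_of_pos (mul_pos hτ hp)]
    nlinarith [he w hw, mul_pos hτ hp]
  simp only [indicator_of_mem hm, le_refl]

/-- The sum of the weighted squared derivatives of order at most `a`, cut off to `Ω`. -/
noncomputable def weightedEnergy {F : Type*} [NormedAddCommGroup F] [NormedSpace ℝ F]
    (σ : E → ℝ) (Ω : Set E) (α : ℝ) (a : ℕ) (u : E → F) : E → ℝ≥0∞ :=
  Ω.indicator fun y => ∑ k ∈ Finset.range (a + 1),
    ENNReal.ofReal ((σ y ^ 2) ^ (α + k)) * ‖iteratedFDeriv ℝ k u y‖ₑ ^ 2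

omit [FiniteDimensional ℝ E] in
theorem measurable_weightedEnergy {F : Type*} [NormedAddCommGroup F] [NormedSpace ℝ F]
    (hσ : Continuous σ) {Ω : Set E} (hΩ : MeasurableSet Ω) (α : ℝ) (a : ℕ) {u : E → F}
    (hu : ContDiff ℝ ∞ u) : Measurable (weightedEnergy σ Ω α a u) := by
  refine Measurable.indicator (Finset.measurable_fun_sum _ fun k _ => ?_) hΩ
  have h1 : Measurable fun y => σ y ^ 2 := (hσ.pow 2).measurable
  have h2 : Continuous (iteratedFDeriv ℝ k u) :=
    hu.continuous_iteratedFDeriv (by exact_mod_cast le_top)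
  exact (h1.pow_const _).ennreal_ofReal.mul (h2.enorm.measurable.pow_const 2)

theorem rpow_le_rpow_abs_mul_rpow {a b c : ℝ} (ha : 0 < a) (hb : 0 < b) (h1 : a ≤ 4 * b)
    (h2 : b ≤ 4 * a) : a ^ c ≤ 4 ^ |c| * b ^ c := by
  rcases le_or_gt 0 c with hc | hc
  · rw [abs_of_nonneg hc, ← Real.mul_rpow (by norm_num) hb.le]
    exact Real.rpow_le_rpow ha.le h1 hc
  · rw [abs_of_neg hc]
    have : b ^ c = 4 ^ c * (b / 4) ^ c := by
      rw [← Real.mul_rpow (by norm_num) (by positivity)]; congr 1; ring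
    rw [this, ← mul_assoc, ← Real.rpow_add (by norm_num), neg_add_cancel, Real.rpow_zero, one_mul]
    exact Real.rpow_le_rpow_of_nonpos (by positivity) (by linarith) hc.le

omit [FiniteDimensional ℝ E] [MeasurableSpace E] [BorelSpace E] in
theorem sum_iteratedFDeriv_comp_le_weightedEnergy {F : Type*} [NormedAddCommGroup F]
    [NormedSpace ℝ F] (hσ : LipschitzWith 1 σ) (hpos : ∀ p, 0 < σ p) {Ω : Set E} (α : ℝ) (a : ℕ)
    {u : E → F} (hu : ContDiff ℝ ∞ u) {p w : E} (hw : ‖w‖ ≤ 1 / 2) {τ : ℝ}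
    (hτ : τ ∈ Ioo (0 : ℝ) 1) (hΩ : p + (τ * σ p) • w ∈ Ω) :
    ENNReal.ofReal ((σ p ^ 2) ^ α) * ∑ k ∈ Finset.range (a + 1),
        ‖iteratedFDeriv ℝ k (fun t : ℝ => u (p + t • (σ p • w))) τ‖ₑ ^ 2 ≤
      ENNReal.ofReal (4 ^ (|α| + a)) * weightedEnergy σ Ω α a u (p + (τ * σ p) • w) := by
  rw [weightedEnergy, indicator_of_mem hΩ, Finset.mul_sum, Finset.mul_sum]
  refine Finset.sum_le_sum fun k hk => ?_
  set y := p + (τ * σ p) • w with hy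
  have hp := hpos p
  have hd : dist y p ≤ σ p / 2 := by
    rw [hy, dist_eq_norm, add_sub_cancel_left, norm_smul, Real.norm_eq_abs,
      abs_of_pos (mul_pos hτ.1 hp)]
    have : τ * σ p ≤ σ p := by nlinarith [hτ.2]
    calc τ * σ p * ‖w‖ ≤ σ p * (1 / 2) := by gcongr
      _ = _ := by ring
  obtain ⟨h1, h2⟩ := le_two_mul_of_dist_le hσ hd
  have hy0 := hpos y
  have hD : ‖iteratedFDeriv ℝ k (fun t : ℝ => u (p + t • (σ p • w))) τ‖ ≤
      σ p ^ k * ‖iteratedFDeriv ℝ k u y‖ := by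
    refine (norm_iteratedFDeriv_comp_add_smul_le hu p (σ p • w) k τ).trans ?_
    rw [smul_smul, ← hy]
    gcongr
    rw [norm_smul, Real.norm_eq_abs, abs_of_pos hp]
    nlinarith
  have hW : (σ p ^ 2) ^ α * (σ p ^ k) ^ 2 ≤ 4 ^ (|α| + a) * (σ y ^ 2) ^ (α + k) := by
    have : (σ p ^ 2) ^ α * (σ p ^ k) ^ 2 = (σ p ^ 2) ^ (α + k) := by
      rw [Real.rpow_add (by positivity), Real.rpow_natCast]; ring
    rw [this]
    refine (rpow_le_rpow_abs_mul_rpow (b := σ y ^ 2) (by positivity) (by positivity)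
      (by nlinarith) (by nlinarith)).trans ?_
    gcongr
    · norm_num
    · refine (abs_add_le _ _).trans ?_
      rw [Nat.abs_cast]
      gcongr
      exact Nat.lt_succ_iff.1 (Finset.mem_range.1 hk)
  have hfin : (σ p ^ 2) ^ α * ‖iteratedFDeriv ℝ k (fun t : ℝ => u (p + t • (σ p • w))) τ‖ ^ 2 ≤
      4 ^ (|α| + a) * ((σ y ^ 2) ^ (α + k) * ‖iteratedFDeriv ℝ k u y‖ ^ 2) := by
    calc _ ≤ (σ p ^ 2) ^ α * (σ p ^ k * ‖iteratedFDeriv ℝ k u y‖) ^ 2 := by gcongr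
      _ = (σ p ^ 2) ^ α * (σ p ^ k) ^ 2 * ‖iteratedFDeriv ℝ k u y‖ ^ 2 := by ring
      _ ≤ 4 ^ (|α| + a) * (σ y ^ 2) ^ (α + k) * ‖iteratedFDeriv ℝ k u y‖ ^ 2 := by gcongr
      _ = _ := by ring
  have := ENNReal.ofReal_le_ofReal hfin
  rwa [ENNReal.ofReal_mul (by positivity), ENNReal.ofReal_mul (by positivity),
    ENNReal.ofReal_mul (by positivity), ENNReal.ofReal_pow (norm_nonneg _),
    ENNReal.ofReal_pow (norm_nonneg _), ofReal_norm, ofReal_norm] at this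

/-- Every point of `Ω` is the vertex of a cone contained in `Ω`, of height comparable to `σ` and
of uniform opening. -/
def UniformConeCondition (σ : E → ℝ) (Ω : Set E) : Prop :=
  ∃ r > 0, ∀ p ∈ Ω, ∃ e : E, ∀ w ∈ closedBall e r, ‖w‖ ≤ 1 / 2 ∧
    ∀ τ ∈ Ioo (0 : ℝ) 1, p + (τ * σ p) • w ∈ Ω

theorem exists_enorm_sq_le_lintegral_ballAvg (F : Type*) [NormedAddCommGroup F] [NormedSpace ℝ F]
    [CompleteSpace F] (hσ : LipschitzWith 1 σ) (hpos : ∀ p, 0 < σ p) {Ω : Set E}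
    (hΩ : MeasurableSet Ω) (hcone : UniformConeCondition σ Ω) (α : ℝ) (a : ℕ) {m : ℝ}
    (hm : m < 2 * a + 1) : ∃ C : ℝ≥0, ∀ u : E → F, ContDiff ℝ ∞ u → ∀ p ∈ Ω,
      ENNReal.ofReal ((σ p ^ 2) ^ α) * ‖u p‖ₑ ^ 2 ≤ C * ∫⁻ τ in Ioo (0 : ℝ) 1,
        ENNReal.ofReal (τ ^ m) * ballAvg μ σ (weightedEnergy σ Ω α (a + 1) u) τ p := by
  have : ProperSpace E := FiniteDimensional.proper ℝ E
  obtain ⟨r, hr, hcone⟩ := hcone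
  obtain ⟨C, hC⟩ := exists_enorm_sq_le_lintegral_rpow_mul F a hm
  have hV0 : μ (closedBall 0 r) ≠ 0 := (measure_closedBall_pos μ _ hr).ne'
  have hVt : μ (closedBall 0 r) ≠ ⊤ := measure_closedBall_lt_top.ne
  set K : ℝ≥0 := (4 ^ (|α| + (a + 1 : ℕ)) : ℝ).toNNReal with hK
  refine ⟨(μ (closedBall 0 r)).toNNReal⁻¹ * (C * K), fun u hu p hp => ?_⟩
  obtain ⟨e, he⟩ := hcone p hp
  set W := weightedEnergy σ Ω α (a + 1) u
  have hW : Measurable W := measurable_weightedEnergy hσ.continuous hΩ α (a + 1) hu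
  have hpt : ∀ w ∈ closedBall e r, ENNReal.ofReal ((σ p ^ 2) ^ α) * ‖u p‖ₑ ^ 2 ≤
      C * K * ∫⁻ τ in Ioo (0 : ℝ) 1, ENNReal.ofReal (τ ^ m) * W (p + (τ * σ p) • w) := by
    intro w hw
    have h := hC (fun t : ℝ => u (p + t • (σ p • w))) (by fun_prop)
    simp only [zero_smul, add_zero] at h
    calc _ ≤ ENNReal.ofReal ((σ p ^ 2) ^ α) * (C * ∫⁻ τ in Ioo (0 : ℝ) 1,
          ENNReal.ofReal (τ ^ m) * ∑ k ∈ Finset.range (a + 2),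
            ‖iteratedFDeriv ℝ k (fun t : ℝ => u (p + t • (σ p • w))) τ‖ₑ ^ 2) := by gcongr
      _ = C * ∫⁻ τ in Ioo (0 : ℝ) 1, ENNReal.ofReal ((σ p ^ 2) ^ α) *
          (ENNReal.ofReal (τ ^ m) * ∑ k ∈ Finset.range (a + 2),
            ‖iteratedFDeriv ℝ k (fun t : ℝ => u (p + t • (σ p • w))) τ‖ₑ ^ 2) := by
          rw [lintegral_const_mul' _ _ ENNReal.ofReal_ne_top]
          ring
      _ ≤ C * ∫⁻ τ in Ioo (0 : ℝ) 1, K * (ENNReal.ofReal (τ ^ m) * W (p + (τ * σ p) • w)) := by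
          gcongr _ * ?_
          refine setLIntegral_mono' measurableSet_Ioo fun τ hτ => ?_
          have := sum_iteratedFDeriv_comp_le_weightedEnergy hσ hpos α (a + 1) hu (he w hw).1 hτ
            ((he w hw).2 τ hτ)
          calc _ = ENNReal.ofReal (τ ^ m) * (ENNReal.ofReal ((σ p ^ 2) ^ α) *
                ∑ k ∈ Finset.range (a + 2),
                ‖iteratedFDeriv ℝ k (fun t : ℝ => u (p + t • (σ p • w))) τ‖ₑ ^ 2) := by ring
            _ ≤ ENNReal.ofReal (τ ^ m) * (K * W (p + (τ * σ p) • w)) := by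
                exact mul_le_mul_right this _
            _ = _ := by ring
      _ = _ := by
          rw [lintegral_const_mul' _ _ ENNReal.coe_ne_top]
          ring
  have hint : μ (closedBall 0 r) * (ENNReal.ofReal ((σ p ^ 2) ^ α) * ‖u p‖ₑ ^ 2) ≤
      C * K * ∫⁻ τ in Ioo (0 : ℝ) 1, ENNReal.ofReal (τ ^ m) * ballAvg μ σ W τ p := by
    calc _ = ∫⁻ _w in closedBall e r, ENNReal.ofReal ((σ p ^ 2) ^ α) * ‖u p‖ₑ ^ 2 ∂μ := by
          rw [setLIntegral_const, Measure.addHaar_closedBall_center μ e, mul_comm]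
      _ ≤ ∫⁻ w in closedBall e r, (C * K * ∫⁻ τ in Ioo (0 : ℝ) 1,
            ENNReal.ofReal (τ ^ m) * W (p + (τ * σ p) • w)) ∂μ :=
          setLIntegral_mono' measurableSet_closedBall hpt
      _ = C * K * ∫⁻ τ in Ioo (0 : ℝ) 1, ∫⁻ w in closedBall e r,
            ENNReal.ofReal (τ ^ m) * W (p + (τ * σ p) • w) ∂μ := by
          rw [lintegral_const_mul' _ _ (ENNReal.mul_ne_top ENNReal.coe_ne_top ENNReal.coe_ne_top),
            lintegral_lintegral_swap]
          refine Measurable.aemeasurable ?_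
          have h1 : Measurable fun z : E × ℝ => p + (z.2 * σ p) • z.1 := by
            have : Continuous fun z : E × ℝ => p + (z.2 * σ p) • z.1 := by fun_prop
            exact this.measurable
          have h2 : Measurable fun z : E × ℝ => ENNReal.ofReal (z.2 ^ m) := by fun_prop
          exact h2.mul (hW.comp h1)
      _ ≤ _ := by
          gcongr _ * ?_
          refine setLIntegral_mono' measurableSet_Ioo fun τ hτ => ?_
          rw [lintegral_const_mul' _ _ ENNReal.ofReal_ne_top]
          gcongr
          exact setLIntegral_comp_add_smul_le_ballAvg μ hW (fun w hw => (he w hw).1) hτ.1 (hpos p)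
  calc _ = (μ (closedBall 0 r))⁻¹ *
        (μ (closedBall 0 r) * (ENNReal.ofReal ((σ p ^ 2) ^ α) * ‖u p‖ₑ ^ 2)) := by
        rw [← mul_assoc, ENNReal.inv_mul_cancel hV0 hVt, one_mul]
    _ ≤ (μ (closedBall 0 r))⁻¹ * (C * K * ∫⁻ τ in Ioo (0 : ℝ) 1,
          ENNReal.ofReal (τ ^ m) * ballAvg μ σ W τ p) := by gcongr
    _ = _ := by
        rw [ENNReal.coe_mul, ENNReal.coe_inv (by
          rw [Ne, ENNReal.toNNReal_eq_zero_iff]; tauto), ENNReal.coe_toNNReal hVt]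
        push_cast
        ring

end BallAverage

section Product

variable {E : Type*} [NormedAddCommGroup E] [NormedSpace ℝ E] [FiniteDimensional ℝ E]
  [MeasurableSpace E] [BorelSpace E] (μ : Measure E) [μ.IsAddHaarMeasure] {σ : E → ℝ}

theorem lintegral_ballAvg_mul_ballAvg_le (hσ : LipschitzWith 1 σ) (hpos : ∀ p, 0 < σ p)
    {F G : E → ℝ≥0∞} (hF : Measurable F) (hG : Measurable G) {τ ρ : ℝ} (hτ : τ ∈ Ioo (0 : ℝ) 1)
    (hρ : ρ ∈ Ioo (0 : ℝ) 1) {c d : ℝ} (hc : 0 ≤ c) (hd : 0 ≤ d) (hcd : c + d = finrank ℝ E) :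
    ∫⁻ p, ENNReal.ofReal (σ p ^ finrank ℝ E) * (ballAvg μ σ F τ p * ballAvg μ σ G ρ p) ∂μ ≤
      2 ^ finrank ℝ E * μ (ball 0 1) * ((∫⁻ y, F y ∂μ) * ∫⁻ y, G y ∂μ) *
        (ENNReal.ofReal (τ ^ (-c)) * ENNReal.ofReal (ρ ^ (-d))) := by
  have hmeas : ∀ {H : E → ℝ≥0∞}, Measurable H → ∀ t : ℝ, Measurable (ballAvg μ σ H t) :=
    fun hH t => (measurable_ballAvg μ hσ.continuous hH).comp (measurable_id.prodMk measurable_const)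
  have key : ∀ {F G : E → ℝ≥0∞}, Measurable F → Measurable G → ∀ {τ ρ : ℝ}, τ ∈ Ioo (0 : ℝ) 1 →
      ρ ∈ Ioo (0 : ℝ) 1 → ∀ {c d : ℝ}, 0 ≤ c → 0 ≤ d → c + d = finrank ℝ E → ρ ≤ τ →
      ∫⁻ p, ENNReal.ofReal (σ p ^ finrank ℝ E) * (ballAvg μ σ F τ p * ballAvg μ σ G ρ p) ∂μ ≤
      2 ^ finrank ℝ E * μ (ball 0 1) * ((∫⁻ y, F y ∂μ) * ∫⁻ y, G y ∂μ) *
        (ENNReal.ofReal (τ ^ (-c)) * ENNReal.ofReal (ρ ^ (-d))) := by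
    intro F G hF hG τ ρ hτ hρ c d hc hd hcd hle
    have hr : (τ ^ finrank ℝ E)⁻¹ ≤ τ ^ (-c) * ρ ^ (-d) := by
      rw [← Real.rpow_natCast, ← hcd, ← Real.rpow_neg hτ.1.le, neg_add, Real.rpow_add hτ.1]
      gcongr ?_ * ?_
      · exact Real.rpow_nonneg hτ.1.le _
      · exact Real.rpow_le_rpow_of_nonpos hρ.1 hle (by linarith)
    calc _ ≤ ∫⁻ p, ENNReal.ofReal (τ ^ finrank ℝ E)⁻¹ * (∫⁻ y, F y ∂μ) * ballAvg μ σ G ρ p ∂μ := by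
          refine lintegral_mono fun p => ?_
          rw [← mul_assoc]
          exact mul_le_mul_left (ofReal_pow_mul_ballAvg_le μ F hτ.1 (hpos p)) _
      _ = ENNReal.ofReal (τ ^ finrank ℝ E)⁻¹ * (∫⁻ y, F y ∂μ) * ∫⁻ p, ballAvg μ σ G ρ p ∂μ :=
          lintegral_const_mul _ (hmeas hG ρ)
      _ ≤ (ENNReal.ofReal (τ ^ (-c)) * ENNReal.ofReal (ρ ^ (-d))) * (∫⁻ y, F y ∂μ) *
          (2 ^ finrank ℝ E * μ (ball 0 1) * ∫⁻ y, G y ∂μ) := by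
          rw [← ENNReal.ofReal_mul (Real.rpow_nonneg hτ.1.le _)]
          exact mul_le_mul' (mul_le_mul_left (ENNReal.ofReal_le_ofReal hr) _)
            (lintegral_ballAvg_le μ hσ hpos hG hρ)
      _ = _ := by ring
  rcases le_total ρ τ with h | h
  · exact key hF hG hτ hρ hc hd hcd h
  · have := key hG hF hρ hτ hd hc (by rw [add_comm, hcd]) h
    simp only [mul_comm (ballAvg μ σ F τ _)]
    rwa [mul_comm (∫⁻ y, F y ∂μ), mul_comm (ENNReal.ofReal (τ ^ (-c)))]

theorem lintegral_mul_lintegral_ballAvg_le (hσ : LipschitzWith 1 σ) (hpos : ∀ p, 0 < σ p)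
    {F G : E → ℝ≥0∞} (hF : Measurable F) (hG : Measurable G) {c d : ℝ} (hc : 0 ≤ c) (hd : 0 ≤ d)
    (hcd : c + d = finrank ℝ E) (m l : ℝ) :
    ∫⁻ p, ENNReal.ofReal (σ p ^ finrank ℝ E) *
        ((∫⁻ τ in Ioo (0 : ℝ) 1, ENNReal.ofReal (τ ^ m) * ballAvg μ σ F τ p) *
          ∫⁻ ρ in Ioo (0 : ℝ) 1, ENNReal.ofReal (ρ ^ l) * ballAvg μ σ G ρ p) ∂μ ≤
      2 ^ finrank ℝ E * μ (ball 0 1) *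
        ((∫⁻ τ in Ioo (0 : ℝ) 1, ENNReal.ofReal (τ ^ (m - c))) *
          ∫⁻ ρ in Ioo (0 : ℝ) 1, ENNReal.ofReal (ρ ^ (l - d))) *
        ((∫⁻ y, F y ∂μ) * ∫⁻ y, G y ∂μ) := by
  set ν := volume.restrict (Ioo (0 : ℝ) 1) with hν
  set M := 2 ^ finrank ℝ E * μ (ball 0 1) * ((∫⁻ y, F y ∂μ) * ∫⁻ y, G y ∂μ) with hM
  have hpow : ∀ k : ℝ, Measurable fun τ : ℝ => ENNReal.ofReal (τ ^ k) := fun k => by fun_prop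
  have hmeas : ∀ {H : E → ℝ≥0∞}, Measurable H → ∀ k : ℝ, Measurable fun q : E × ℝ =>
      ENNReal.ofReal (q.2 ^ k) * ballAvg μ σ H q.2 q.1 := fun hH k =>
    ((hpow k).comp measurable_snd).mul (measurable_ballAvg μ hσ.continuous hH)
  have hsec : ∀ {H : E → ℝ≥0∞}, Measurable H → ∀ (k : ℝ) (p : E), Measurable fun τ : ℝ =>
      ENNReal.ofReal (τ ^ k) * ballAvg μ σ H τ p := fun hH k p =>
    (hmeas hH k).comp measurable_prodMk_left
  have hσN : Measurable fun p => ENNReal.ofReal (σ p ^ finrank ℝ E) :=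
    (hσ.continuous.pow _).measurable.ennreal_ofReal
  calc _ = ∫⁻ p, ∫⁻ z : ℝ × ℝ, ENNReal.ofReal (σ p ^ finrank ℝ E) *
          ((ENNReal.ofReal (z.1 ^ m) * ballAvg μ σ F z.1 p) *
            (ENNReal.ofReal (z.2 ^ l) * ballAvg μ σ G z.2 p)) ∂(ν.prod ν) ∂μ := by
        refine lintegral_congr fun p => ?_
        rw [lintegral_const_mul' _ _ ENNReal.ofReal_ne_top, lintegral_prod_mul
          (hsec hF m p).aemeasurable (hsec hG l p).aemeasurable]
    _ = ∫⁻ z : ℝ × ℝ, ∫⁻ p, ENNReal.ofReal (σ p ^ finrank ℝ E) *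
          ((ENNReal.ofReal (z.1 ^ m) * ballAvg μ σ F z.1 p) *
            (ENNReal.ofReal (z.2 ^ l) * ballAvg μ σ G z.2 p)) ∂μ ∂(ν.prod ν) := by
        refine lintegral_lintegral_swap (Measurable.aemeasurable ?_)
        refine (hσN.comp measurable_fst).mul (((hmeas hF m).comp
          (measurable_fst.prodMk (measurable_fst.comp measurable_snd))).mul ((hmeas hG l).comp
          (measurable_fst.prodMk (measurable_snd.comp measurable_snd))))
    _ ≤ ∫⁻ z : ℝ × ℝ, M * (ENNReal.ofReal (z.1 ^ (m - c)) * ENNReal.ofReal (z.2 ^ (l - d)))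
          ∂(ν.prod ν) := by
        rw [hν, Measure.prod_restrict]
        refine setLIntegral_mono' (measurableSet_Ioo.prod measurableSet_Ioo) fun z hz => ?_
        obtain ⟨hz1, hz2⟩ := hz
        calc _ = ENNReal.ofReal (z.1 ^ m) * ENNReal.ofReal (z.2 ^ l) *
              ∫⁻ p, ENNReal.ofReal (σ p ^ finrank ℝ E) *
                (ballAvg μ σ F z.1 p * ballAvg μ σ G z.2 p) ∂μ := by
              rw [← lintegral_const_mul' _ _
                (ENNReal.mul_ne_top ENNReal.ofReal_ne_top ENNReal.ofReal_ne_top)]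
              refine lintegral_congr fun p => ?_
              ring
          _ ≤ ENNReal.ofReal (z.1 ^ m) * ENNReal.ofReal (z.2 ^ l) *
              (M * (ENNReal.ofReal (z.1 ^ (-c)) * ENNReal.ofReal (z.2 ^ (-d)))) :=
              mul_le_mul_right
                (lintegral_ballAvg_mul_ballAvg_le μ hσ hpos hF hG hz1 hz2 hc hd hcd) _
          _ = M * ((ENNReal.ofReal (z.1 ^ m) * ENNReal.ofReal (z.1 ^ (-c))) *
              (ENNReal.ofReal (z.2 ^ l) * ENNReal.ofReal (z.2 ^ (-d)))) := by ring
          _ = _ := by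
              rw [← ENNReal.ofReal_mul (Real.rpow_nonneg hz1.1.le _),
                ← ENNReal.ofReal_mul (Real.rpow_nonneg hz2.1.le _), ← Real.rpow_add hz1.1,
                ← Real.rpow_add hz2.1, sub_eq_add_neg, sub_eq_add_neg]
    _ = _ := by
        have h : Measurable fun z : ℝ × ℝ =>
            ENNReal.ofReal (z.1 ^ (m - c)) * ENNReal.ofReal (z.2 ^ (l - d)) := by fun_prop
        rw [lintegral_const_mul _ h, lintegral_prod_mul (hpow _).aemeasurable
          (hpow _).aemeasurable, hM]
        ring

theorem exists_enorm_sq_le_lintegral_weightedEnergy (F : Type*) [NormedAddCommGroup F]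
    [NormedSpace ℝ F] [CompleteSpace F] (hσ : LipschitzWith 1 σ) (hpos : ∀ p, 0 < σ p) {Ω : Set E}
    (hΩ : MeasurableSet Ω) (hcone : UniformConeCondition σ Ω) (α : ℝ) {a : ℕ}
    (ha : (finrank ℝ E : ℝ) < 2 * a) : ∃ C : ℝ≥0, ∀ u : E → F, ContDiff ℝ ∞ u → ∀ p ∈ Ω,
      ENNReal.ofReal (σ p ^ finrank ℝ E) * (ENNReal.ofReal ((σ p ^ 2) ^ α) * ‖u p‖ₑ ^ 2) ≤
        C * ∫⁻ y, weightedEnergy σ Ω α a u y ∂μ := by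
  obtain _ | a := a
  · exact absurd ha (by simp)
  obtain ⟨m, hm1, hm2⟩ := exists_between (show (finrank ℝ E : ℝ) - 1 < 2 * a + 1 by
    push_cast at ha; linarith)
  obtain ⟨C, hC⟩ := exists_enorm_sq_le_lintegral_ballAvg μ F hσ hpos hΩ hcone α a hm2
  have hI := lintegral_Ioo_rpow_lt_top (c := m - finrank ℝ E) (by linarith)
  refine ⟨C * (∫⁻ t in Ioo (0 : ℝ) 1, ENNReal.ofReal (t ^ (m - finrank ℝ E))).toNNReal,
    fun u hu p hp => ?_⟩
  rw [ENNReal.coe_mul, ENNReal.coe_toNNReal hI.ne]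
  set W := weightedEnergy σ Ω α (a + 1) u
  calc _ ≤ ENNReal.ofReal (σ p ^ finrank ℝ E) * (C * ∫⁻ τ in Ioo (0 : ℝ) 1,
        ENNReal.ofReal (τ ^ m) * ballAvg μ σ W τ p) := mul_le_mul_right (hC u hu p hp) _
    _ = C * ∫⁻ τ in Ioo (0 : ℝ) 1, ENNReal.ofReal (σ p ^ finrank ℝ E) *
        (ENNReal.ofReal (τ ^ m) * ballAvg μ σ W τ p) := by
        rw [lintegral_const_mul' _ _ ENNReal.ofReal_ne_top]
        ring
    _ ≤ C * ∫⁻ τ in Ioo (0 : ℝ) 1, ENNReal.ofReal (τ ^ (m - finrank ℝ E)) * ∫⁻ y, W y ∂μ := by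
        refine mul_le_mul_right (setLIntegral_mono' measurableSet_Ioo fun τ hτ => ?_) _
        calc _ = ENNReal.ofReal (τ ^ m) *
              (ENNReal.ofReal (σ p ^ finrank ℝ E) * ballAvg μ σ W τ p) := by ring
          _ ≤ ENNReal.ofReal (τ ^ m) * (ENNReal.ofReal (τ ^ finrank ℝ E)⁻¹ * ∫⁻ y, W y ∂μ) :=
              mul_le_mul_right (ofReal_pow_mul_ballAvg_le μ W hτ.1 (hpos p)) _
          _ = _ := by
              rw [← mul_assoc, ← ENNReal.ofReal_mul (Real.rpow_nonneg hτ.1.le _),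
                Real.rpow_sub hτ.1, Real.rpow_natCast, div_eq_mul_inv]
    _ = _ := by
        have : Measurable fun τ : ℝ => ENNReal.ofReal (τ ^ (m - finrank ℝ E)) := by fun_prop
        rw [lintegral_mul_const _ this, mul_assoc]

omit [FiniteDimensional ℝ E] [MeasurableSpace E] [BorelSpace E] in
theorem ofReal_mul_enorm_sq_le_weightedEnergy {F : Type*} [NormedAddCommGroup F]
    [NormedSpace ℝ F] {Ω : Set E} (α : ℝ) (a : ℕ) (u : E → F) {p : E} (hp : p ∈ Ω) :
    ENNReal.ofReal ((σ p ^ 2) ^ α) * ‖u p‖ₑ ^ 2 ≤ weightedEnergy σ Ω α a u p := by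
  rw [weightedEnergy, indicator_of_mem hp]
  refine le_trans (le_of_eq ?_) (Finset.single_le_sum (fun _ _ => zero_le)
    (Finset.mem_range.2 a.succ_pos))
  rw [Nat.cast_zero, add_zero, ← ofReal_norm (iteratedFDeriv ℝ 0 u p), norm_iteratedFDeriv_zero,
    ofReal_norm]

theorem exists_setLIntegral_mul_le_of_zero (F G : Type*) [NormedAddCommGroup F]
    [NormedSpace ℝ F] [NormedAddCommGroup G] [NormedSpace ℝ G]
    [CompleteSpace G] (hσ : LipschitzWith 1 σ) (hpos : ∀ p, 0 < σ p) {Ω : Set E}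
    (hΩ : MeasurableSet Ω) (hcone : UniformConeCondition σ Ω) (α β : ℝ) (a : ℕ) {b : ℕ}
    (hb : (finrank ℝ E : ℝ) < 2 * b) :
    ∃ C : ℝ≥0, ∀ (u : E → F) (v : E → G), ContDiff ℝ ∞ u → ContDiff ℝ ∞ v →
      ∫⁻ p in Ω, ENNReal.ofReal (σ p ^ finrank ℝ E) *
        ((ENNReal.ofReal ((σ p ^ 2) ^ α) * ‖u p‖ₑ ^ 2) *
          (ENNReal.ofReal ((σ p ^ 2) ^ β) * ‖v p‖ₑ ^ 2)) ∂μ ≤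
      C * ((∫⁻ y, weightedEnergy σ Ω α a u y ∂μ) * ∫⁻ y, weightedEnergy σ Ω β b v y ∂μ) := by
  obtain ⟨C, hC⟩ := exists_enorm_sq_le_lintegral_weightedEnergy μ G hσ hpos hΩ hcone β hb
  refine ⟨C, fun u v hu hv => ?_⟩
  have hW := measurable_weightedEnergy hσ.continuous hΩ α a hu
  calc _ ≤ ∫⁻ p in Ω, weightedEnergy σ Ω α a u p *
        (C * ∫⁻ y, weightedEnergy σ Ω β b v y ∂μ) ∂μ := by
        refine setLIntegral_mono' hΩ fun p hp => ?_
        rw [mul_left_comm]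
        exact mul_le_mul' (ofReal_mul_enorm_sq_le_weightedEnergy α a u hp) (hC v hv p hp)
    _ ≤ ∫⁻ p, weightedEnergy σ Ω α a u p * (C * ∫⁻ y, weightedEnergy σ Ω β b v y ∂μ) ∂μ :=
        setLIntegral_le_lintegral _ _
    _ = _ := by
        rw [lintegral_mul_const _ hW]
        ring

/-- Weighted product estimate: `u` and `v` have `a` and `b` derivatives in weighted `L²`, with
`dim E < 2(a + b)`, and the product gains the weight `σ^{dim E / 2}`. -/
theorem exists_setLIntegral_mul_le (F G : Type*) [NormedAddCommGroup F]
    [NormedSpace ℝ F] [CompleteSpace F] [NormedAddCommGroup G] [NormedSpace ℝ G]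
    [CompleteSpace G] (hσ : LipschitzWith 1 σ) (hpos : ∀ p, 0 < σ p) {Ω : Set E}
    (hΩ : MeasurableSet Ω) (hcone : UniformConeCondition σ Ω) (α β : ℝ) {a b : ℕ}
    (hab : (finrank ℝ E : ℝ) < 2 * (a + b)) :
    ∃ C : ℝ≥0, ∀ (u : E → F) (v : E → G), ContDiff ℝ ∞ u → ContDiff ℝ ∞ v →
      ∫⁻ p in Ω, ENNReal.ofReal (σ p ^ finrank ℝ E) *
        ((ENNReal.ofReal ((σ p ^ 2) ^ α) * ‖u p‖ₑ ^ 2) *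
          (ENNReal.ofReal ((σ p ^ 2) ^ β) * ‖v p‖ₑ ^ 2)) ∂μ ≤
      C * ((∫⁻ y, weightedEnergy σ Ω α a u y ∂μ) * ∫⁻ y, weightedEnergy σ Ω β b v y ∂μ) := by
  obtain _ | a := a
  · exact exists_setLIntegral_mul_le_of_zero μ F G hσ hpos hΩ hcone α β 0 (by simpa using hab)
  obtain _ | b := b
  · obtain ⟨C, hC⟩ := exists_setLIntegral_mul_le_of_zero μ G F hσ hpos hΩ hcone β α 0
      (b := a + 1) (by simpa using hab)
    refine ⟨C, fun u v hu hv => ?_⟩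
    have := hC v u hv hu
    rw [mul_comm (∫⁻ y, weightedEnergy σ Ω β 0 v y ∂μ)] at this
    refine le_trans (le_of_eq (lintegral_congr fun p => ?_)) this
    ring
  push_cast at hab
  set N : ℝ := (finrank ℝ E : ℝ) with hN
  have hN0 : 0 ≤ N := Nat.cast_nonneg _
  set c : ℝ := (a + 1) / (a + 1 + (b + 1)) * N with hc
  set d : ℝ := (b + 1) / (a + 1 + (b + 1)) * N with hd
  have hcd : c + d = N := by rw [hc, hd]; field_simp
  have hca : c < 2 * (a + 1) := by
    rw [hc, div_mul_eq_mul_div, div_lt_iff₀ (by positivity)]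
    nlinarith [show (0 : ℝ) < a + 1 by positivity]
  have hdb : d < 2 * (b + 1) := by
    rw [hd, div_mul_eq_mul_div, div_lt_iff₀ (by positivity)]
    nlinarith [show (0 : ℝ) < b + 1 by positivity]
  obtain ⟨m, hm1, hm2⟩ := exists_between (show c - 1 < 2 * a + 1 by linarith)
  obtain ⟨l, hl1, hl2⟩ := exists_between (show d - 1 < 2 * b + 1 by linarith)
  obtain ⟨C, hC⟩ := exists_enorm_sq_le_lintegral_ballAvg μ F hσ hpos hΩ hcone α a hm2
  obtain ⟨D, hD⟩ := exists_enorm_sq_le_lintegral_ballAvg μ G hσ hpos hΩ hcone β b hl2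
  have hI := lintegral_Ioo_rpow_lt_top (c := m - c) (by linarith)
  have hJ := lintegral_Ioo_rpow_lt_top (c := l - d) (by linarith)
  have hB : 2 ^ finrank ℝ E * μ (ball 0 1) *
        ((∫⁻ τ in Ioo (0 : ℝ) 1, ENNReal.ofReal (τ ^ (m - c))) *
          ∫⁻ ρ in Ioo (0 : ℝ) 1, ENNReal.ofReal (ρ ^ (l - d))) ≠ ⊤ := by
    have : ProperSpace E := FiniteDimensional.proper ℝ E
    exact ENNReal.mul_ne_top (ENNReal.mul_ne_top (by simp) measure_ball_lt_top.ne)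
      (ENNReal.mul_ne_top hI.ne hJ.ne)
  refine ⟨C * D * (2 ^ finrank ℝ E * μ (ball 0 1) *
        ((∫⁻ τ in Ioo (0 : ℝ) 1, ENNReal.ofReal (τ ^ (m - c))) *
          ∫⁻ ρ in Ioo (0 : ℝ) 1, ENNReal.ofReal (ρ ^ (l - d)))).toNNReal, fun u v hu hv => ?_⟩
  rw [ENNReal.coe_mul, ENNReal.coe_mul, ENNReal.coe_toNNReal hB]
  have hU := measurable_weightedEnergy hσ.continuous hΩ α (a + 1) hu
  have hV := measurable_weightedEnergy hσ.continuous hΩ β (b + 1) hv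
  set U := weightedEnergy σ Ω α (a + 1) u
  set V := weightedEnergy σ Ω β (b + 1) v
  calc _ ≤ ∫⁻ p in Ω, C * D * (ENNReal.ofReal (σ p ^ finrank ℝ E) *
        ((∫⁻ τ in Ioo (0 : ℝ) 1, ENNReal.ofReal (τ ^ m) * ballAvg μ σ U τ p) *
          ∫⁻ ρ in Ioo (0 : ℝ) 1, ENNReal.ofReal (ρ ^ l) * ballAvg μ σ V ρ p)) ∂μ := by
        refine setLIntegral_mono' hΩ fun p hp => ?_
        refine (mul_le_mul_right (mul_le_mul' (hC u hu p hp) (hD v hv p hp)) _).trans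
          (le_of_eq ?_)
        ring
    _ ≤ ∫⁻ p, C * D * (ENNReal.ofReal (σ p ^ finrank ℝ E) *
        ((∫⁻ τ in Ioo (0 : ℝ) 1, ENNReal.ofReal (τ ^ m) * ballAvg μ σ U τ p) *
          ∫⁻ ρ in Ioo (0 : ℝ) 1, ENNReal.ofReal (ρ ^ l) * ballAvg μ σ V ρ p)) ∂μ :=
        setLIntegral_le_lintegral _ _
    _ ≤ _ := by
        rw [lintegral_const_mul' _ _ (ENNReal.mul_ne_top ENNReal.coe_ne_top ENNReal.coe_ne_top)]
        exact (mul_le_mul_right (lintegral_mul_lintegral_ballAvg_le μ hσ hpos hU hV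
          (by positivity) (by positivity) hcd m l) _).trans (le_of_eq (mul_assoc _ _ _).symm)

end Product

section Algebra

variable {E : Type*} [NormedAddCommGroup E] [NormedSpace ℝ E] {σ : E → ℝ}

theorem weightedEnergy_iteratedFDeriv_le {F : Type*} [NormedAddCommGroup F] [NormedSpace ℝ F]
    (Ω : Set E) (α : ℝ) {a j s : ℕ} (h : j + a = s) (f : E → F) (p : E) :
    weightedEnergy σ Ω (α + j) a (iteratedFDeriv ℝ j f) p ≤ weightedEnergy σ Ω α s f p := by
  subst h
  rw [weightedEnergy, weightedEnergy]
  refine indicator_le_indicator ?_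
  calc _ = ∑ k ∈ Finset.range (a + 1), ENNReal.ofReal ((σ p ^ 2) ^ (α + (j + k : ℕ))) *
        ‖iteratedFDeriv ℝ (j + k) f p‖ₑ ^ 2 := by
        refine Finset.sum_congr rfl fun k _ => ?_
        rw [← ofReal_norm, norm_iteratedFDeriv_iteratedFDeriv, ofReal_norm, add_comm k j,
          Nat.cast_add, add_assoc]
    _ = ∑ k ∈ Finset.Ico j (j + a + 1), ENNReal.ofReal ((σ p ^ 2) ^ (α + k)) *
        ‖iteratedFDeriv ℝ k f p‖ₑ ^ 2 := by
        rw [Finset.sum_Ico_eq_sum_range, add_assoc, Nat.add_sub_cancel_left]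
    _ ≤ _ := by
        refine Finset.sum_le_sum_of_subset fun k hk => ?_
        exact Finset.mem_range.2 (Finset.mem_Ico.1 hk).2

theorem enorm_iteratedFDeriv_mul_sq_le {f g : E → ℝ} (hf : ContDiff ℝ ∞ f) (hg : ContDiff ℝ ∞ g)
    (k : ℕ) (p : E) :
    ‖iteratedFDeriv ℝ k (fun x => f x * g x) p‖ₑ ^ 2 ≤ (k + 1 : ℕ) * ∑ j ∈ Finset.range (k + 1),
      (k.choose j : ℝ≥0∞) ^ 2 *
        (‖iteratedFDeriv ℝ j f p‖ₑ ^ 2 * ‖iteratedFDeriv ℝ (k - j) g p‖ₑ ^ 2) := by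
  have h := norm_iteratedFDeriv_mul_le hf hg p (n := k) (by exact_mod_cast le_top)
  have h' : ‖iteratedFDeriv ℝ k (fun x => f x * g x) p‖ₑ ≤ ∑ j ∈ Finset.range (k + 1),
      (k.choose j : ℝ≥0∞) * ‖iteratedFDeriv ℝ j f p‖ₑ * ‖iteratedFDeriv ℝ (k - j) g p‖ₑ := by
    refine (ofReal_norm _).symm.trans_le ((ENNReal.ofReal_le_ofReal h).trans (le_of_eq ?_))
    rw [ENNReal.ofReal_sum_of_nonneg fun _ _ => by positivity]
    refine Finset.sum_congr rfl fun j _ => ?_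
    rw [ENNReal.ofReal_mul (by positivity), ENNReal.ofReal_mul (by positivity), ofReal_norm,
      ofReal_norm, ENNReal.ofReal_natCast]
  refine (pow_le_pow_left₀ zero_le h' 2).trans ((ennreal_sum_sq_le_card_mul_sum_sq _ _).trans
    (le_of_eq ?_))
  rw [Finset.card_range]
  congr 1
  refine Finset.sum_congr rfl fun j _ => ?_
  ring

theorem rpow_le_pow_mul_rpow_mul_rpow {x δ δ₁ δ₂ : ℝ} (hx : 1 ≤ x) {N j k : ℕ} (hjk : j ≤ k)
    (hδ : 2 * δ ≤ 2 * (δ₁ + δ₂) + N) :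
    (x ^ 2) ^ (δ + k) ≤ x ^ N * ((x ^ 2) ^ (δ₁ + j) * (x ^ 2) ^ (δ₂ + (k - j : ℕ))) := by
  have hx0 : 0 < x := by linarith
  rw [← Real.rpow_natCast x 2, ← Real.rpow_natCast x N, ← Real.rpow_mul hx0.le,
    ← Real.rpow_mul hx0.le, ← Real.rpow_mul hx0.le, ← Real.rpow_add hx0, ← Real.rpow_add hx0]
  refine Real.rpow_le_rpow_of_exponent_le hx ?_
  push_cast [Nat.cast_sub hjk]
  linarith

variable [FiniteDimensional ℝ E] [MeasurableSpace E] [BorelSpace E] (μ : Measure E)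
  [μ.IsAddHaarMeasure]

/-- Multiplication in weighted Sobolev spaces over a domain satisfying the uniform cone condition,
in terms of the squared norms. -/
theorem exists_lintegral_weightedEnergy_mul_le (hσ : LipschitzWith 1 σ) (hσ1 : ∀ p, 1 ≤ σ p)
    {Ω : Set E} (hΩ : MeasurableSet Ω) (hcone : UniformConeCondition σ Ω) {s s₁ s₂ : ℕ}
    {δ δ₁ δ₂ : ℝ} (h₁ : s ≤ s₁) (h₂ : s ≤ s₂)
    (hs : (finrank ℝ E : ℝ) < 2 * ((s₁ : ℝ) + s₂ - s))
    (hδ : 2 * δ ≤ 2 * (δ₁ + δ₂) + finrank ℝ E) :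
    ∃ C : ℝ≥0, ∀ f g : E → ℝ, ContDiff ℝ ∞ f → ContDiff ℝ ∞ g →
      ∫⁻ p, weightedEnergy σ Ω δ s (fun x => f x * g x) p ∂μ ≤
        C * ((∫⁻ p, weightedEnergy σ Ω δ₁ s₁ f p ∂μ) *
          ∫⁻ p, weightedEnergy σ Ω δ₂ s₂ g p ∂μ) := by
  have htop : ∀ i : ℕ, ((⊤ : ℕ∞) : WithTop ℕ∞) + i ≤ (⊤ : ℕ∞) := fun i => by exact_mod_cast le_top
  have hpos : ∀ p, 0 < σ p := fun p => zero_lt_one.trans_le (hσ1 p)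
  have hterm : ∀ k j : ℕ, ∃ C : ℝ≥0, k ≤ s → j ≤ k → ∀ f g : E → ℝ,
      ContDiff ℝ ∞ f → ContDiff ℝ ∞ g →
      ∫⁻ p in Ω, ENNReal.ofReal (σ p ^ finrank ℝ E) *
        ((ENNReal.ofReal ((σ p ^ 2) ^ (δ₁ + j)) * ‖iteratedFDeriv ℝ j f p‖ₑ ^ 2) *
          (ENNReal.ofReal ((σ p ^ 2) ^ (δ₂ + (k - j : ℕ))) *
            ‖iteratedFDeriv ℝ (k - j) g p‖ₑ ^ 2)) ∂μ ≤
        C * ((∫⁻ p, weightedEnergy σ Ω δ₁ s₁ f p ∂μ) *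
          ∫⁻ p, weightedEnergy σ Ω δ₂ s₂ g p ∂μ) := by
    intro k j
    by_cases hkj : k ≤ s ∧ j ≤ k
    · obtain ⟨hk, hj⟩ := hkj
      have hdim : (finrank ℝ E : ℝ) < 2 * ((s₁ - j : ℕ) + (s₂ - (k - j) : ℕ)) := by
        rw [Nat.cast_sub (by omega), Nat.cast_sub (by omega), Nat.cast_sub hj]
        have : (k : ℝ) ≤ s := by exact_mod_cast hk
        linarith
      obtain ⟨C, hC⟩ := exists_setLIntegral_mul_le μ (E [×j]→L[ℝ] ℝ) (E [×(k - j)]→L[ℝ] ℝ) hσ hpos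
        hΩ hcone (δ₁ + j) (δ₂ + (k - j : ℕ)) hdim
      refine ⟨C, fun _ _ f g hf hg => (hC _ _ (hf.iteratedFDeriv_right (m := ∞) (htop _))
        (hg.iteratedFDeriv_right (m := ∞) (htop _))).trans ?_⟩
      refine mul_le_mul_right (mul_le_mul' (lintegral_mono fun p => ?_)
        (lintegral_mono fun p => ?_)) _
      · exact weightedEnergy_iteratedFDeriv_le Ω δ₁ (by omega) f p
      · exact weightedEnergy_iteratedFDeriv_le Ω δ₂ (by omega) g p
    · exact ⟨0, fun hk hj => absurd ⟨hk, hj⟩ hkj⟩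
  choose C hC using hterm
  refine ⟨∑ k ∈ Finset.range (s + 1), ∑ j ∈ Finset.range (k + 1),
    (k + 1 : ℕ) * (k.choose j : ℝ≥0) ^ 2 * C k j, fun f g hf hg => ?_⟩
  set X := ∫⁻ p, weightedEnergy σ Ω δ₁ s₁ f p ∂μ
  set Y := ∫⁻ p, weightedEnergy σ Ω δ₂ s₂ g p ∂μ
  set T : ℕ → ℕ → E → ℝ≥0∞ := fun k j p => ENNReal.ofReal (σ p ^ finrank ℝ E) *
        ((ENNReal.ofReal ((σ p ^ 2) ^ (δ₁ + j)) * ‖iteratedFDeriv ℝ j f p‖ₑ ^ 2) *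
          (ENNReal.ofReal ((σ p ^ 2) ^ (δ₂ + (k - j : ℕ))) *
            ‖iteratedFDeriv ℝ (k - j) g p‖ₑ ^ 2)) with hT
  have hTm : ∀ k j, Measurable (T k j) := by
    intro k j
    have hσ2 : Measurable fun y => σ y ^ 2 := (hσ.continuous.pow 2).measurable
    have hD : ∀ {h : E → ℝ}, ContDiff ℝ ∞ h → ∀ i : ℕ, Measurable fun p =>
        ‖iteratedFDeriv ℝ i h p‖ₑ ^ 2 := fun hh i =>
      (hh.continuous_iteratedFDeriv (by exact_mod_cast le_top)).enorm.measurable.pow_const 2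
    exact (hσ.continuous.pow _).measurable.ennreal_ofReal.mul
      (((hσ2.pow_const _).ennreal_ofReal.mul (hD hf _)).mul
        ((hσ2.pow_const _).ennreal_ofReal.mul (hD hg _)))
  calc _ = ∫⁻ p in Ω, ∑ k ∈ Finset.range (s + 1), ENNReal.ofReal ((σ p ^ 2) ^ (δ + k)) *
        ‖iteratedFDeriv ℝ k (fun x => f x * g x) p‖ₑ ^ 2 ∂μ := lintegral_indicator hΩ _
    _ ≤ ∫⁻ p in Ω, ∑ k ∈ Finset.range (s + 1), ∑ j ∈ Finset.range (k + 1),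
        ((k + 1 : ℕ) * (k.choose j : ℝ≥0∞) ^ 2) * T k j p ∂μ := by
        refine lintegral_mono fun p => Finset.sum_le_sum fun k _ => ?_
        refine (mul_le_mul_right (enorm_iteratedFDeriv_mul_sq_le hf hg k p) _).trans ?_
        rw [Finset.mul_sum, Finset.mul_sum]
        refine Finset.sum_le_sum fun j hj => ?_
        have hw := ENNReal.ofReal_le_ofReal (rpow_le_pow_mul_rpow_mul_rpow (hσ1 p)
          (Nat.lt_succ_iff.1 (Finset.mem_range.1 hj)) hδ)
        have hp := hpos p
        rw [ENNReal.ofReal_mul (by positivity), ENNReal.ofReal_mul (by positivity)] at hw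
        calc _ = ENNReal.ofReal ((σ p ^ 2) ^ (δ + k)) * ((k + 1 : ℕ) * (k.choose j : ℝ≥0∞) ^ 2 *
              (‖iteratedFDeriv ℝ j f p‖ₑ ^ 2 * ‖iteratedFDeriv ℝ (k - j) g p‖ₑ ^ 2)) := by ring
          _ ≤ _ := mul_le_mul_left hw _
          _ = _ := by rw [hT]; ring
    _ = ∑ k ∈ Finset.range (s + 1), ∑ j ∈ Finset.range (k + 1),
        ((k + 1 : ℕ) * (k.choose j : ℝ≥0∞) ^ 2) * ∫⁻ p in Ω, T k j p ∂μ := by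
        rw [lintegral_finsetSum _ fun k _ => Finset.measurable_fun_sum _ fun j _ =>
          (hTm k j).const_mul _]
        refine Finset.sum_congr rfl fun k _ => ?_
        rw [lintegral_finsetSum _ fun j _ => (hTm k j).const_mul _]
        exact Finset.sum_congr rfl fun j _ => lintegral_const_mul _ (hTm k j)
    _ ≤ ∑ k ∈ Finset.range (s + 1), ∑ j ∈ Finset.range (k + 1),
        ((k + 1 : ℕ) * (k.choose j : ℝ≥0∞) ^ 2) * (C k j * (X * Y)) := by
        refine Finset.sum_le_sum fun k hk => Finset.sum_le_sum fun j hj => ?_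
        exact mul_le_mul_right (hC k j (Nat.lt_succ_iff.1 (Finset.mem_range.1 hk))
          (Nat.lt_succ_iff.1 (Finset.mem_range.1 hj)) f g hf hg) _
    _ = _ := by
        push_cast
        rw [Finset.sum_mul]
        refine Finset.sum_congr rfl fun k _ => ?_
        rw [Finset.sum_mul]
        refine Finset.sum_congr rfl fun j _ => ?_
        ring

end Algebra

section BoostRegion

/-- The weight `σ(x) = (1+|x|²)^{1/2}` as a function on spacetime. -/
noncomputable def spatialWeight (n : ℕ) (p : EuclideanSpace ℝ (Fin n) × ℝ) : ℝ :=
  √(1 + ‖p.1‖ ^ 2)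

theorem spatialWeight_sq {n : ℕ} (p : EuclideanSpace ℝ (Fin n) × ℝ) :
    spatialWeight n p ^ 2 = 1 + ‖p.1‖ ^ 2 :=
  Real.sq_sqrt (by positivity)

theorem one_le_spatialWeight {n : ℕ} (p : EuclideanSpace ℝ (Fin n) × ℝ) :
    1 ≤ spatialWeight n p :=
  Real.one_le_sqrt.2 (by linarith [sq_nonneg ‖p.1‖])

theorem spatialWeight_le_add {n : ℕ} (p q : EuclideanSpace ℝ (Fin n) × ℝ) :
    spatialWeight n p ≤ spatialWeight n q + ‖p.1 - q.1‖ := by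
  have hp := spatialWeight_sq p
  have hq := spatialWeight_sq q
  have hq1 := one_le_spatialWeight q
  have h1 : ‖p.1‖ ≤ ‖q.1‖ + ‖p.1 - q.1‖ := by
    have := norm_add_le q.1 (p.1 - q.1)
    rwa [add_sub_cancel] at this
  have h2 : ‖q.1‖ ≤ spatialWeight n q := Real.le_sqrt_of_sq_le (by linarith)
  refine Real.sqrt_le_iff.2 ⟨by positivity, ?_⟩
  nlinarith [norm_nonneg (p.1 - q.1), norm_nonneg p.1]

theorem lipschitzWith_spatialWeight (n : ℕ) : LipschitzWith 1 (spatialWeight n) := by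
  refine LipschitzWith.of_le_add fun p q => (spatialWeight_le_add p q).trans ?_
  rw [dist_eq_norm]
  exact add_le_add_right (norm_fst_le (p - q)) _

theorem measurableSet_boostRegion (n : ℕ) (θ : ℝ) : MeasurableSet (boostRegion n θ) :=
  (isClosed_le (by fun_prop) (by fun_prop)).measurableSet

theorem uniformConeCondition_boostRegion (n : ℕ) {θ : ℝ} (hθ : θ ∈ Ioc (0 : ℝ) 1) :
    UniformConeCondition (spatialWeight n) (boostRegion n θ) := by
  obtain ⟨hθ0, hθ1⟩ := hθ
  refine ⟨θ / 8, by positivity, fun p hp => ?_⟩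
  have hp' : |p.2| ≤ θ * spatialWeight n p := hp
  have hp1 := one_le_spatialWeight p
  obtain ⟨ε, hε, hpε⟩ : ∃ ε : ℝ, (ε = 1 ∨ ε = -1) ∧ p.2 = ε * |p.2| := by
    rcases le_total 0 p.2 with h | h
    · exact ⟨1, Or.inl rfl, by rw [abs_of_nonneg h, one_mul]⟩
    · exact ⟨-1, Or.inr rfl, by rw [abs_of_nonpos h]; ring⟩
  refine ⟨(0, -(ε * (3 * θ / 8))), fun w hw => ?_⟩
  rw [mem_closedBall, Prod.dist_eq, max_le_iff, dist_zero_right, Real.dist_eq, abs_le] at hw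
  obtain ⟨hw1, hw2, hw3⟩ := hw
  have hbound : θ / 4 ≤ -(ε * w.2) ∧ -(ε * w.2) ≤ θ / 2 := by
    rcases hε with rfl | rfl <;> constructor <;> linarith
  have hw2abs : |w.2| ≤ θ / 2 := by
    rw [abs_le]
    rcases hε with rfl | rfl <;> constructor <;> linarith
  refine ⟨?_, fun τ hτ => ?_⟩
  · rw [Prod.norm_def, Real.norm_eq_abs]
    exact max_le (by linarith) (by linarith)
  · have hσ := spatialWeight_le_add p (p + (τ * spatialWeight n p) • w)
    rw [Prod.fst_add, Prod.smul_fst, sub_add_cancel_left, norm_neg, norm_smul, Real.norm_eq_abs,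
      abs_of_pos (mul_pos hτ.1 (by linarith))] at hσ
    set q := p + (τ * spatialWeight n p) • w with hq
    set S := spatialWeight n p
    have hτS : 0 < τ * S := mul_pos hτ.1 (by linarith)
    have hτS1 : τ * S ≤ S := by nlinarith [hτ.2]
    have hq2 : |q.2| = |(|p.2| - τ * S * (-(ε * w.2)))| := by
      rw [hq, Prod.snd_add, Prod.smul_snd, smul_eq_mul]
      nth_rewrite 1 [hpε]
      rcases hε with rfl | rfl
      · congr 1; ring
      · rw [← abs_neg]; congr 1; ring
    have hqS : S - τ * S * (θ / 8) ≤ spatialWeight n q := by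
      nlinarith
    suffices |q.2| ≤ θ * spatialWeight n q from this
    refine le_trans ?_ (mul_le_mul_of_nonneg_left hqS hθ0.le)
    rw [hq2, abs_le]
    have h3 : τ * S * (θ * (θ / 8)) ≤ τ * S * (θ / 8) :=
      mul_le_mul_of_nonneg_left (by nlinarith) hτS.le
    have h4 : τ * S * (θ / 4) ≤ τ * S * (-(ε * w.2)) :=
      mul_le_mul_of_nonneg_left hbound.1 hτS.le
    have h5 : τ * S * (-(ε * w.2)) ≤ τ * S * (θ / 2) :=
      mul_le_mul_of_nonneg_left hbound.2 hτS.le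
    have h6 : τ * S * θ ≤ S * θ := mul_le_mul_of_nonneg_right hτS1 hθ0.le
    have h7 := abs_nonneg p.2
    have h8 := mul_pos hτS hθ0
    constructor <;> nlinarith

theorem wSobOn_eq_lintegral_weightedEnergy (n s : ℕ) (δ : ℝ)
    {U : Set (EuclideanSpace ℝ (Fin n) × ℝ)} (hU : MeasurableSet U)
    {u : EuclideanSpace ℝ (Fin n) × ℝ → ℝ} (hu : ContDiff ℝ ∞ u) :
    wSobOn n s δ U u =
      (∫⁻ p, weightedEnergy (spatialWeight n) U δ s u p) ^ (1 / 2 : ℝ) := by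
  have h1 : Measurable fun p => spatialWeight n p ^ 2 :=
    ((lipschitzWith_spatialWeight n).continuous.pow 2).measurable
  have h2 : ∀ k : ℕ, Measurable fun p => ENNReal.ofReal ((spatialWeight n p ^ 2) ^ (δ + k)) *
      ‖iteratedFDeriv ℝ k u p‖ₑ ^ 2 := fun k => by
    have : Continuous (iteratedFDeriv ℝ k u) :=
      hu.continuous_iteratedFDeriv (by exact_mod_cast le_top)
    exact (h1.pow_const _).ennreal_ofReal.mul (this.enorm.measurable.pow_const 2)
  rw [wSobOn]
  congr 1
  unfold weightedEnergy
  rw [lintegral_indicator hU, lintegral_finsetSum _ fun k _ => h2 k]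
  refine Finset.sum_congr rfl fun k _ => lintegral_congr fun p => ?_
  rw [spatialWeight_sq, ENNReal.ofReal_mul (by positivity), ENNReal.ofReal_pow (norm_nonneg _),
    ofReal_norm]

end BoostRegion

end

end WeightedSobolev

/-- **Weighted Sobolev multiplication inequality on the boost region**: if `s ≤ s₁`,
`s ≤ s₂`, `s < s₁ + s₂ − (n+1)/2` and `δ < δ₁ + δ₂ + (n+1)/2`, then there is a constant `C`
such that `‖f₁·f₂‖_{H_{s,δ}(Ω_θ)} ≤ C ‖f₁‖_{H_{s₁,δ₁}(Ω_θ)} ‖f₂‖_{H_{s₂,δ₂}(Ω_θ)}` for all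
smooth `f₁, f₂` with finite corresponding norms. -/
theorem weighted_sobolev_multiplication_boost
    (n : ℕ) (hn : 1 ≤ n) (θ : ℝ) (hθ : θ ∈ Set.Ioc (0 : ℝ) 1)
    (s s₁ s₂ : ℕ) (δ δ₁ δ₂ : ℝ)
    (h₁ : s ≤ s₁) (h₂ : s ≤ s₂)
    (hs : (s : ℝ) < (s₁ : ℝ) + s₂ - (n + 1) / 2) (hδ : δ < δ₁ + δ₂ + (n + 1) / 2) :
    ∃ C : ℝ, 0 < C ∧
      ∀ f₁ f₂ : EuclideanSpace ℝ (Fin n) × ℝ → ℝ,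
        ContDiff ℝ (⊤ : ℕ∞) f₁ → ContDiff ℝ (⊤ : ℕ∞) f₂ →
        wSobOn n s₁ δ₁ (boostRegion n θ) f₁ < ⊤ →
        wSobOn n s₂ δ₂ (boostRegion n θ) f₂ < ⊤ →
        wSobOn n s δ (boostRegion n θ) (fun p => f₁ p * f₂ p)
          ≤ ENNReal.ofReal C * wSobOn n s₁ δ₁ (boostRegion n θ) f₁
              * wSobOn n s₂ δ₂ (boostRegion n θ) f₂ := by
  have hdim : Module.finrank ℝ (EuclideanSpace ℝ (Fin n) × ℝ) = n + 1 := by simp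
  have hΩ := WeightedSobolev.measurableSet_boostRegion n θ
  have : (volume : Measure (EuclideanSpace ℝ (Fin n) × ℝ)).IsAddHaarMeasure :=
    Measure.prod.instIsAddHaarMeasure volume volume
  obtain ⟨C, hC⟩ := WeightedSobolev.exists_lintegral_weightedEnergy_mul_le
    (volume : Measure (EuclideanSpace ℝ (Fin n) × ℝ))
    (WeightedSobolev.lipschitzWith_spatialWeight n) WeightedSobolev.one_le_spatialWeight hΩ
    (WeightedSobolev.uniformConeCondition_boostRegion n hθ) (δ := δ) (δ₁ := δ₁) (δ₂ := δ₂) h₁ h₂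
    (by rw [hdim]; push_cast; linarith) (by rw [hdim]; push_cast; linarith)
  refine ⟨((C : ℝ) + 1) ^ (1 / 2 : ℝ), by positivity, fun f₁ f₂ hf₁ hf₂ _ _ => ?_⟩
  rw [WeightedSobolev.wSobOn_eq_lintegral_weightedEnergy n s δ hΩ (hf₁.mul hf₂),
    WeightedSobolev.wSobOn_eq_lintegral_weightedEnergy n s₁ δ₁ hΩ hf₁,
    WeightedSobolev.wSobOn_eq_lintegral_weightedEnergy n s₂ δ₂ hΩ hf₂, mul_assoc,
    ← ENNReal.ofReal_rpow_of_nonneg (by positivity) (by norm_num),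
    ← ENNReal.mul_rpow_of_nonneg _ _ (by norm_num), ← ENNReal.mul_rpow_of_nonneg _ _ (by norm_num)]
  refine ENNReal.rpow_le_rpow ((hC f₁ f₂ hf₁ hf₂).trans (mul_le_mul_left ?_ _)) (by norm_num)
  rw [← ENNReal.ofReal_coe_nnreal]
  exact ENNReal.ofReal_le_ofReal (by linarith)
end
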